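/- arXiv:1302.0133 — 3 statements merged into one kernel-verified Lean document; each statement's English description precedes it below -/
import Mathlib

section
/- Let n ≥ 2, a > 2 be integers, and let R = ℤ[x₁,x₂]/⟨x₁^{n+1}, x₂(a·x₁ + x₂)⟩ be the graded ring with x₁, x₂ in degree 2. Then every graded ring automorphism of R sends x₁ to ±x₁; more precisely the group of graded ring automorphisms of R has exactly four elements, given on (x₁,x₂) by the matrices I, −I, (1,0;−a,−1), and (−1,0;a,1). -/
open MvPolynomial

/-- `R = ℤ[x₁,x₂]/⟨x₁^{n+1}, x₂(a·x₁+x₂)⟩`, the cohomology ring of `P(ℂ ⊕ γ^a)` over `ℂPⁿ`,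
with both generators in degree 2. -/
noncomputable abbrev Rq (n : ℕ) (a : ℤ) : Type :=
  MvPolynomial (Fin 2) ℤ ⧸
    Ideal.span ({(X 0 : MvPolynomial (Fin 2) ℤ) ^ (n + 1),
      X 1 * (C a * X 0 + X 1)} : Set (MvPolynomial (Fin 2) ℤ))

/-- the degree-2 generator `x₁`. -/
noncomputable def x₁ (n : ℕ) (a : ℤ) : Rq n a := Ideal.Quotient.mk _ (X 0)

/-- the degree-2 generator `x₂`. -/
noncomputable def x₂ (n : ℕ) (a : ℤ) : Rq n a := Ideal.Quotient.mk _ (X 1)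

theorem rel₁ (n : ℕ) (a : ℤ) : (x₁ n a) ^ (n + 1) = 0 := by
  unfold x₁
  rw [← map_pow, Ideal.Quotient.eq_zero_iff_mem]
  exact Ideal.subset_span (by simp)

theorem rel₂ (n : ℕ) (a : ℤ) : x₂ n a * ((a : Rq n a) * x₁ n a + x₂ n a) = 0 := by
  have h : (Ideal.Quotient.mk _ (X 1 * (C a * X 0 + X 1)) : Rq n a) = 0 := by
    rw [Ideal.Quotient.eq_zero_iff_mem]
    exact Ideal.subset_span (by simp)
  simpa [x₁, x₂] using h

/-- Maps out of the quotient ring. -/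
theorem exists_hom (n : ℕ) (a : ℤ) {S : Type} [CommRing S] (u v : S) (hu : u ^ (n + 1) = 0)
    (hv : v * ((a : S) * u + v) = 0) :
    ∃ f : Rq n a →+* S, f (x₁ n a) = u ∧ f (x₂ n a) = v := by
  refine ⟨Ideal.Quotient.lift _ (MvPolynomial.eval₂Hom (Int.castRingHom S) ![u, v]) ?_, ?_, ?_⟩
  · intro P hP
    rw [Ideal.mem_span_pair] at hP
    obtain ⟨A, B, rfl⟩ := hP
    have hC : eval₂ (Int.castRingHom S) ![u, v] (C a) = (a : S) := by rw [eval₂_C]; rfl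
    simp only [coe_eval₂Hom, eval₂_add, eval₂_mul, eval₂_pow, eval₂_X, hC]
    simp [hu, hv]
  · simp [x₁]
  · simp [x₂]

theorem Rq_induction (n : ℕ) (a : ℤ) (M : Rq n a → Prop) (hC : ∀ z : ℤ, M (z : Rq n a))
    (hadd : ∀ y w, M y → M w → M (y + w)) (h1 : ∀ y, M y → M (y * x₁ n a))
    (h2 : ∀ y, M y → M (y * x₂ n a)) (y : Rq n a) : M y := by
  obtain ⟨P, rfl⟩ := Ideal.Quotient.mk_surjective y
  induction P using MvPolynomial.induction_on with
  | C z => simpa using hC z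
  | add P Q hP hQ => rw [map_add]; exact hadd _ _ hP hQ
  | mul_X P i hP =>
    rw [map_mul]
    fin_cases i
    · exact h1 _ hP
    · exact h2 _ hP

theorem hom_ext' (n : ℕ) (a : ℤ) {S : Type} [CommRing S] (f g : Rq n a →+* S)
    (h1 : f (x₁ n a) = g (x₁ n a)) (h2 : f (x₂ n a) = g (x₂ n a)) (y : Rq n a) : f y = g y := by
  induction y using Rq_induction with
  | hC z => simp
  | hadd y w hy hw => simp [hy, hw]
  | h1 y hy => simp [hy, h1]
  | h2 y hy => simp [hy, h2]

/-- Linear part of an element, detected by dual numbers. -/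
theorem linear_part (n : ℕ) (a : ℤ) (y : Rq n a) :
    ∃ c0 c1 c2 : ℤ, ∀ (f : Rq n a →+* DualNumber ℤ) (A B : ℤ),
      f (x₁ n a) = TrivSqZeroExt.inr A → f (x₂ n a) = TrivSqZeroExt.inr B →
      (f y).fst = c0 ∧ (f y).snd = c1 * A + c2 * B := by
  induction y using Rq_induction with
  | hC z =>
    refine ⟨z, 0, 0, fun f A B _ _ => ?_⟩
    simp
  | hadd y w hy hw =>
    obtain ⟨c0, c1, c2, hc⟩ := hy
    obtain ⟨d0, d1, d2, hd⟩ := hw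
    refine ⟨c0 + d0, c1 + d1, c2 + d2, fun f A B hA hB => ?_⟩
    obtain ⟨e1, e2⟩ := hc f A B hA hB
    obtain ⟨e3, e4⟩ := hd f A B hA hB
    simp only [map_add, TrivSqZeroExt.fst_add, TrivSqZeroExt.snd_add, e1, e2, e3, e4]
    exact ⟨trivial, by ring⟩
  | h1 y hy =>
    obtain ⟨c0, c1, c2, hc⟩ := hy
    refine ⟨0, c0, 0, fun f A B hA hB => ?_⟩
    obtain ⟨e1, e2⟩ := hc f A B hA hB
    simp [hA, e1]
  | h2 y hy =>
    obtain ⟨c0, c1, c2, hc⟩ := hy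
    refine ⟨0, 0, c0, fun f A B hA hB => ?_⟩
    obtain ⟨e1, e2⟩ := hc f A B hA hB
    simp [hB, e1]

theorem det_unit (n : ℕ) (a : ℤ) (hn : 2 ≤ n) (φ : Rq n a ≃+* Rq n a) (p q r s : ℤ)
    (h1 : φ (x₁ n a) = p * x₁ n a + q * x₂ n a) (h2 : φ (x₂ n a) = r * x₁ n a + s * x₂ n a) :
    IsUnit (p * s - q * r) := by
  have key : ∀ u v : ℤ, ∃ f : Rq n a →+* DualNumber ℤ,
      f (x₁ n a) = TrivSqZeroExt.inr u ∧ f (x₂ n a) = TrivSqZeroExt.inr v := by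
    intro u v
    apply exists_hom
    · obtain ⟨m, rfl⟩ := Nat.exists_eq_add_of_le hn
      rw [show 2 + m + 1 = 2 + (m + 1) by ring, pow_add, pow_two, TrivSqZeroExt.inr_mul_inr, zero_mul]
    · ext <;> simp
  have main : ∀ y : Rq n a, ∃ c1 c2 : ℤ, ∀ (f : Rq n a →+* DualNumber ℤ) (u v : ℤ),
      f (x₁ n a) = TrivSqZeroExt.inr u → f (x₂ n a) = TrivSqZeroExt.inr v →
      (f y).snd = c1 * (p * u + q * v) + c2 * (r * u + s * v) := by
    intro y
    obtain ⟨c0, c1, c2, hc⟩ := linear_part n a (φ.symm y)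
    refine ⟨c1, c2, fun f u v hu hv => ?_⟩
    have := (hc (f.comp (φ : Rq n a →+* Rq n a)) (p * u + q * v) (r * u + s * v) ?_ ?_).2
    · simpa using this
    · simp only [RingHom.comp_apply, RingHom.coe_coe, h1]
      ext <;> simp [hu, hv]
    · simp only [RingHom.comp_apply, RingHom.coe_coe, h2]
      ext <;> simp [hu, hv]
  obtain ⟨f, f1, f2⟩ := key 1 0
  obtain ⟨g, g1, g2⟩ := key 0 1
  obtain ⟨c1, c2, hc⟩ := main (x₁ n a)
  obtain ⟨d1, d2, hd⟩ := main (x₂ n a)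
  have e1 := hc f 1 0 f1 f2
  have e2 := hc g 0 1 g1 g2
  have e3 := hd f 1 0 f1 f2
  have e4 := hd g 0 1 g1 g2
  simp only [f1, f2, g1, g2, TrivSqZeroExt.snd_inr] at e1 e2 e3 e4
  apply IsUnit.of_mul_eq_one (c1 * d2 - c2 * d1)
  have e1' : c1 * p + c2 * r = 1 := by linarith
  have e2' : c1 * q + c2 * s = 0 := by linarith
  have e3' : d1 * p + d2 * r = 0 := by linarith
  have e4' : d1 * q + d2 * s = 1 := by linarith
  linear_combination (d1 * q + d2 * s) * e1' - (d1 * p + d2 * r) * e2' + e4'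

theorem mk_zero (n : ℕ) (a : ℤ) (P : MvPolynomial (Fin 2) ℤ)
    (h : MvPolynomial.aeval ![x₁ n a, x₂ n a] P = 0) :
    ∃ A B, A * (X 0) ^ (n + 1) + B * (X 1 * (C a * X 0 + X 1)) = P := by
  rw [← Ideal.mem_span_pair, ← Ideal.Quotient.eq_zero_iff_mem, ← h]
  clear h
  induction P using MvPolynomial.induction_on with
  | C z => simp
  | add P Q hP hQ => rw [map_add, map_add, hP, hQ]
  | mul_X P i hP =>
    rw [map_mul, map_mul, hP]
    fin_cases i <;> simp [x₁, x₂]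

theorem coef_zero (n : ℕ) (hn : 2 ≤ n) (c : ℤ) (A : Polynomial ℤ)
    (h : A * Polynomial.X ^ (n + 1) = Polynomial.C c * Polynomial.X ^ 2) : c = 0 := by
  have := congrArg (fun P => Polynomial.coeff P 2) h
  simp only [Polynomial.coeff_mul_X_pow', Polynomial.coeff_C_mul_X_pow] at this
  simpa [show ¬ (n + 1 ≤ 2) by omega] using this.symm

theorem quad_rel (n : ℕ) (a : ℤ) (hn : 2 ≤ n) (p q r s : ℤ)
    (h : ((r : Rq n a) * x₁ n a + s * x₂ n a) *
      (a * (p * x₁ n a + q * x₂ n a) + (r * x₁ n a + s * x₂ n a)) = 0) :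
    r * (a * p + r) = 0 ∧ (r - a * s) * (a * (p - a * q) + (r - a * s)) = 0 := by
  obtain ⟨A, B, hAB⟩ := mk_zero n a ((C r * X 0 + C s * X 1) *
    (C a * (C p * X 0 + C q * X 1) + (C r * X 0 + C s * X 1))) (by simpa using h)
  have h1 := congrArg (MvPolynomial.aeval ![(Polynomial.X : Polynomial ℤ), 0]) hAB
  have h2 := congrArg (MvPolynomial.aeval
    ![(Polynomial.X : Polynomial ℤ), -((a : Polynomial ℤ) * Polynomial.X)]) hAB
  simp at h1 h2
  constructor
  · apply coef_zero n hn _ _ (h1.trans _)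
    simp
    ring
  · apply coef_zero n hn _ _ (h2.trans _)
    simp
    ring

theorem pow_rel (n : ℕ) (a : ℤ) (p q : ℤ)
    (h : ((p : Rq n a) * x₁ n a + q * x₂ n a) ^ (n + 1) = 0) :
    p ^ (n + 1) = (p - a * q) ^ (n + 1) := by
  obtain ⟨A, B, hAB⟩ := mk_zero n a ((C p * X 0 + C q * X 1) ^ (n + 1)) (by simpa using h)
  have h1 := congrArg (MvPolynomial.aeval ![(Polynomial.X : Polynomial ℤ), 0]) hAB
  have h2 := congrArg (MvPolynomial.aeval
    ![(Polynomial.X : Polynomial ℤ), -((a : Polynomial ℤ) * Polynomial.X)]) hAB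
  have h3 : ∀ v : Polynomial ℤ, v.eval 0 = 0 →
      Polynomial.eval 0 (MvPolynomial.aeval ![(Polynomial.X : Polynomial ℤ), v] A)
        = MvPolynomial.eval 0 A := by
    intro v hv
    clear hAB h1 h2
    induction A using MvPolynomial.induction_on with
    | C z => simp
    | add P Q hP hQ => simp only [map_add, Polynomial.eval_add, hP, hQ]
    | mul_X P i hP => fin_cases i <;> simp [hv]
  have hX : (Polynomial.X : Polynomial ℤ) ^ (n + 1) ≠ 0 := pow_ne_zero _ Polynomial.X_ne_zero
  have k1 : MvPolynomial.aeval ![(Polynomial.X : Polynomial ℤ), 0] A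
      = Polynomial.C (p ^ (n + 1)) := by
    apply mul_right_cancel₀ hX
    simp at h1
    rw [h1, mul_pow]; simp
  have k2 : MvPolynomial.aeval ![(Polynomial.X : Polynomial ℤ), -((a : Polynomial ℤ) * Polynomial.X)] A
      = Polynomial.C ((p - a * q) ^ (n + 1)) := by
    apply mul_right_cancel₀ hX
    simp at h2
    rw [h2, Polynomial.C_pow, ← mul_pow]; simp; ring
  have l1 := h3 0 (by simp)
  have l2 := h3 (-((a : Polynomial ℤ) * Polynomial.X)) (by simp)
  rw [k1] at l1
  rw [k2] at l2
  simp only [Polynomial.eval_C] at l1 l2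
  rw [l1, l2]

theorem arith (n : ℕ) (a p q r s : ℤ) (ha : 2 < a) (hd : IsUnit (p * s - q * r))
    (h1 : r * (a * p + r) = 0) (h2 : (r - a * s) * (a * (p - a * q) + (r - a * s)) = 0)
    (h3 : p ^ (n + 1) = (p - a * q) ^ (n + 1)) :
    q = 0 ∧ (p = 1 ∨ p = -1) ∧ ((r = 0 ∧ s = p) ∨ (r = - a * p ∧ s = -p)) := by
  have ha0 : a ≠ 0 := by omega
  have hp : p = 1 ∨ p = -1 := by
    rcases mul_eq_zero.1 h1 with h | h
    · subst h
      have : IsUnit (p * s) := by simpa using hd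
      exact Int.isUnit_iff.1 (isUnit_of_mul_isUnit_left this)
    · obtain rfl : r = - a * p := by linarith
      have : IsUnit (p * (s + a * q)) := by convert hd using 1; ring
      exact Int.isUnit_iff.1 (isUnit_of_mul_isUnit_left this)
  have hq : q = 0 := by
    have habs : |p| = |p - a * q| := by
      have := congrArg abs h3
      rw [abs_pow, abs_pow] at this
      exact (pow_left_inj₀ (abs_nonneg _) (abs_nonneg _) (by omega)).1 this
    rcases abs_eq_abs.1 habs with h | h
    · have : a * q = 0 := by linarith
      exact (mul_eq_zero.1 this).resolve_left ha0
    · have h2p : a * q = 2 * p := by linarith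
      have : a ∣ 2 := by
        rcases hp with rfl | rfl
        · exact ⟨q, by linarith⟩
        · exact ⟨-q, by linarith⟩
      have := Int.le_of_dvd (by norm_num) this
      omega
  subst hq
  refine ⟨rfl, hp, ?_⟩
  have hs : s ≠ 0 := by
    rintro rfl
    simp at hd
  rcases mul_eq_zero.1 h1 with h | h
  · subst h
    left
    refine ⟨rfl, ?_⟩
    have : (a * a * s) * (s - p) = 0 := by linear_combination h2
    have := (mul_eq_zero.1 this).resolve_left (by positivity)
    linarith
  · right
    have hr : r = - a * p := by linarith
    refine ⟨hr, ?_⟩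
    subst hr
    have : (a * a * s) * (s + p) = 0 := by linear_combination h2
    have := (mul_eq_zero.1 this).resolve_left (by positivity)
    linarith

theorem exists_equiv (n : ℕ) (a e r s : ℤ) (he : e * e = 1) (hs : s * s = 1)
    (hr : r * e + s * r = 0) (h1 : r * (a * e + r) = 0) (h2 : s * (2 * r + a * e) = a) :
    ∃ φ : Rq n a ≃+* Rq n a, φ (x₁ n a) = e * x₁ n a ∧
      φ (x₂ n a) = r * x₁ n a + s * x₂ n a := by
  have c1 : (e : Rq n a) * e = 1 := by exact_mod_cast congrArg (Int.cast : ℤ → Rq n a) he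
  have c2 : (s : Rq n a) * s = 1 := by exact_mod_cast congrArg (Int.cast : ℤ → Rq n a) hs
  have c3 : (r : Rq n a) * e + s * r = 0 := by
    exact_mod_cast congrArg (Int.cast : ℤ → Rq n a) hr
  have c4 : (r : Rq n a) * (a * e + r) = 0 := by
    exact_mod_cast congrArg (Int.cast : ℤ → Rq n a) h1
  have c5 : (s : Rq n a) * (2 * r + a * e) = a := by
    exact_mod_cast congrArg (Int.cast : ℤ → Rq n a) h2
  obtain ⟨f, f1, f2⟩ := exists_hom n a ((e : Rq n a) * x₁ n a) (r * x₁ n a + s * x₂ n a)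
    (by rw [mul_pow, rel₁, mul_zero])
    (by linear_combination (x₁ n a) ^ 2 * c4 + x₁ n a * x₂ n a * c5 + (x₂ n a) ^ 2 * c2 + rel₂ n a)
  have hff : f.comp f = RingHom.id _ := by
    refine RingHom.ext fun y => ?_
    apply hom_ext'
    · simp only [RingHom.comp_apply, f1, map_mul, map_intCast, RingHom.id_apply]
      linear_combination x₁ n a * c1
    · simp only [RingHom.comp_apply, f1, f2, map_mul, map_add, map_intCast, RingHom.id_apply]
      linear_combination x₁ n a * c3 + x₂ n a * c2
  exact ⟨RingEquiv.ofRingHom f f hff hff, f1, f2⟩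

/-- For `n ≥ 2` and `a > 2`, every graded ring automorphism of
`R = ℤ[x₁,x₂]/⟨x₁^{n+1}, x₂(a·x₁+x₂)⟩` (identified with the 2×2 integer matrix of its action
on the degree-2 part, which is free with basis `x₁,x₂`) is one of the four matrices
`I, -I, (1,0;-a,-1), (-1,0;a,1)`; and conversely each of these four matrices is realized by
a graded ring automorphism.  In particular every graded automorphism sends `x₁` to `±x₁`. -/
theorem stmt0 (n : ℕ) (a : ℤ) (hn : 2 ≤ n) (ha : 2 < a) :
    (∀ (φ : Rq n a ≃+* Rq n a) (g : Matrix (Fin 2) (Fin 2) ℤ),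
        φ (x₁ n a) = g 0 0 • x₁ n a + g 0 1 • x₂ n a →
        φ (x₂ n a) = g 1 0 • x₁ n a + g 1 1 • x₂ n a →
        g ∈ ({1, -1, !![1, 0; -a, -1], !![-1, 0; a, 1]} :
          Set (Matrix (Fin 2) (Fin 2) ℤ))) ∧
    (∀ g ∈ ({1, -1, !![1, 0; -a, -1], !![-1, 0; a, 1]} :
          Set (Matrix (Fin 2) (Fin 2) ℤ)),
        ∃ φ : Rq n a ≃+* Rq n a,
          φ (x₁ n a) = g 0 0 • x₁ n a + g 0 1 • x₂ n a ∧
          φ (x₂ n a) = g 1 0 • x₁ n a + g 1 1 • x₂ n a) := by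
  constructor
  · intro φ g h1 h2
    rw [zsmul_eq_mul, zsmul_eq_mul] at h1 h2
    have hd := det_unit n a hn φ _ _ _ _ h1 h2
    have hq := quad_rel n a hn (g 0 0) (g 0 1) (g 1 0) (g 1 1) (by
      rw [← h1, ← h2]
      have := congrArg φ (rel₂ n a)
      simpa using this)
    have hp := pow_rel n a (g 0 0) (g 0 1) (by
      rw [← h1, ← map_pow, rel₁, map_zero])
    obtain ⟨e1, e2, e3⟩ := arith n a _ _ _ _ ha hd hq.1 hq.2 hp
    have hg : g = !![g 0 0, g 0 1; g 1 0, g 1 1] := Matrix.eta_fin_two g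
    rw [hg, e1]
    simp only [Set.mem_insert_iff, Set.mem_singleton_iff]
    rcases e2 with e | e <;> rcases e3 with ⟨e4, e5⟩ | ⟨e4, e5⟩ <;> rw [e4, e5, e]
    · left; exact Matrix.one_fin_two.symm
    · right; right; left; simp
    · right; left; rw [Matrix.one_fin_two]; simp
    · right; right; right; simp
  · intro g hg
    simp only [Set.mem_insert_iff, Set.mem_singleton_iff] at hg
    rcases hg with rfl | rfl | rfl | rfl
    · obtain ⟨φ, h1, h2⟩ := exists_equiv n a 1 0 1 (by ring) (by ring) (by ring) (by ring) (by ring)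
      exact ⟨φ, by rw [h1]; simp; try ring, by rw [h2]; simp; try ring⟩
    · obtain ⟨φ, h1, h2⟩ := exists_equiv n a (-1) 0 (-1) (by ring) (by ring) (by ring) (by ring) (by ring)
      exact ⟨φ, by rw [h1]; simp; try ring, by rw [h2]; simp; try ring⟩
    · obtain ⟨φ, h1, h2⟩ := exists_equiv n a 1 (-a) (-1) (by ring) (by ring) (by ring) (by ring) (by ring)
      exact ⟨φ, by rw [h1]; simp; try ring, by rw [h2]; simp; try ring⟩
    · obtain ⟨φ, h1, h2⟩ := exists_equiv n a (-1) a 1 (by ring) (by ring) (by ring) (by ring) (by ring)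
      exact ⟨φ, by rw [h1]; simp; try ring, by rw [h2]; simp; try ring⟩
end

section
/- Let n, m ≥ 2 and let R = ℤ[x₁,x₂]/⟨x₁·∏_{i=1}^n (x₁ + b_i·x₂), x₂·∏_{j=1}^m (a_j·x₁ + x₂)⟩ with generators in degree 2, where b = (1,…,1,0,…,0) has r ones (1 ≤ r ≤ n) and a = (2,…,2,0,…,0) has s twos (1 ≤ s ≤ m), with s ≠ (m+1)/2 and r ≠ (n+1)/2. Then the group of graded ring automorphisms of R is {±I} ≅ ℤ/2. -/
open MvPolynomial

/-- `R = ℤ[x₁,x₂]/⟨x₁·∏ᵢ(x₁+bᵢx₂), x₂·∏ⱼ(aⱼx₁+x₂)⟩`, the integral cohomology ring of a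
quasitoric manifold over `Δⁿ × Δᵐ`, generators in degree 2. -/
noncomputable abbrev RM (n m : ℕ) (a : Fin m → ℤ) (b : Fin n → ℤ) : Type :=
  MvPolynomial (Fin 2) ℤ ⧸
    Ideal.span ({X 0 * ∏ i : Fin n, (X 0 + C (b i) * X 1),
      X 1 * ∏ j : Fin m, (C (a j) * X 0 + X 1)} : Set (MvPolynomial (Fin 2) ℤ))

noncomputable def z₁ (n m : ℕ) (a : Fin m → ℤ) (b : Fin n → ℤ) : RM n m a b :=
  Ideal.Quotient.mk _ (X 0)

noncomputable def z₂ (n m : ℕ) (a : Fin m → ℤ) (b : Fin n → ℤ) : RM n m a b :=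
  Ideal.Quotient.mk _ (X 1)

/-- An automorphism of `R` is graded iff it preserves the degree-2 part `ℤx₁ ⊕ ℤx₂`. -/
def IsGraded (n m : ℕ) (a : Fin m → ℤ) (b : Fin n → ℤ) (φ : RingAut (RM n m a b)) : Prop :=
  φ (z₁ n m a b) ∈ Submodule.span ℤ ({z₁ n m a b, z₂ n m a b} : Set (RM n m a b)) ∧
  φ (z₂ n m a b) ∈ Submodule.span ℤ ({z₁ n m a b, z₂ n m a b} : Set (RM n m a b))

def fP (k r : ℕ) {S : Type} [CommRing S] (x y : S) : S := x ^ k * (x + y) ^ r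
def fQ (l s : ℕ) {S : Type} [CommRing S] (x y : S) : S := y ^ l * (2 * x + y) ^ s

lemma unit_mul_cases {a b : ℤ} (h : a * b = 1 ∨ a * b = -1) :
    (a = 1 ∨ a = -1) ∧ (b = 1 ∨ b = -1) := by
  have ha : IsUnit a := by
    rcases h with h | h
    · exact IsUnit.of_mul_eq_one _ h
    · exact IsUnit.of_mul_eq_one (-b) (by linarith)
  have hb : IsUnit b := by
    rcases h with h | h
    · exact IsUnit.of_mul_eq_one a (by linarith)
    · exact IsUnit.of_mul_eq_one (-a) (by linarith)
  exact ⟨Int.isUnit_iff.1 ha, Int.isUnit_iff.1 hb⟩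

lemma one_add_eps_pow (c : ℤ) (k : ℕ) :
    ((1 : DualNumber ℤ) + (c : DualNumber ℤ) * DualNumber.eps) ^ k
      = 1 + ((k * c : ℤ) : DualNumber ℤ) * DualNumber.eps := by
  induction k with
  | zero => simp
  | succ k ih =>
    rw [pow_succ, ih]
    have := DualNumber.eps_mul_eps (R := ℤ)
    push_cast
    linear_combination ((k : DualNumber ℤ) * c * c) * this

lemma eps_pow {k : ℕ} (hk : 2 ≤ k) : (DualNumber.eps : DualNumber ℤ) ^ k = 0 := by
  obtain ⟨j, rfl⟩ := Nat.exists_eq_add_of_le hk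
  rw [pow_add, pow_two, DualNumber.eps_mul_eps, zero_mul]

/-- compare dual numbers -/
lemma dual_cmp {e d a b : ℤ} (he : e ≠ 0)
    (h : (e : DualNumber ℤ) * (1 + (a : DualNumber ℤ) * DualNumber.eps)
      = (d : DualNumber ℤ) * (1 + (b : DualNumber ℤ) * DualNumber.eps)) : a = b := by
  have h1 := congrArg TrivSqZeroExt.fst h
  have h2 := congrArg TrivSqZeroExt.snd h
  simp at h1 h2
  rw [← h1] at h2
  refine mul_left_cancel₀ he ?_
  simpa [he] using h2

lemma excl1 {k r l s : ℕ} (hkr : 3 ≤ k + r) (hk : 1 ≤ k) (hls : l ≠ s) {p d : ℤ}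
    (hp : p = 1 ∨ p = -1)
    (h : ∀ x y : DualNumber ℤ, ∃ A, fQ l s ((p : DualNumber ℤ) * x) (-p * (2 * x + y))
      = A * fP k r x y + d * fQ l s x y) : False := by
  apply hls
  have hp0 : p ≠ 0 := by omega
  by_cases h2 : 2 ≤ k
  · obtain ⟨A, hA⟩ := h DualNumber.eps 1
    simp only [fP, fQ, eps_pow h2] at hA
    have := dual_cmp (e := (-p) ^ (l + s)) (d := d) (a := l * 2) (b := s * 2)
      (pow_ne_zero _ (neg_ne_zero.2 hp0)) (by
        rw [← one_add_eps_pow, ← one_add_eps_pow]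
        push_cast
        rw [show (2 * (↑p * DualNumber.eps) + -↑p * (2 * DualNumber.eps + 1) : DualNumber ℤ) = -p by ring,
          show (2 * DualNumber.eps + 1 : DualNumber ℤ) = 1 + 2 * DualNumber.eps by ring] at hA
        simp only [mul_pow, one_mul, pow_add, one_pow] at hA ⊢
        linear_combination hA)
    omega
  · have hr : 2 ≤ r := by omega
    obtain ⟨A, hA⟩ := h 1 (-1 + DualNumber.eps)
    simp only [fP, fQ] at hA
    rw [show (1 + (-1 + DualNumber.eps) : DualNumber ℤ) = DualNumber.eps by ring, eps_pow hr] at hA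
    have e1 := one_add_eps_pow 1 l
    have e2 := one_add_eps_pow (-1) l
    have e3 := one_add_eps_pow 1 s
    have e4 := one_add_eps_pow (-1) s
    have hee := DualNumber.eps_mul_eps (R := ℤ)
    have := dual_cmp (e := (-p) ^ (l + s) * (-1) ^ s) (d := d * (-1) ^ l) (a := l - s) (b := s - l)
      (mul_ne_zero (pow_ne_zero _ (neg_ne_zero.2 hp0)) (by simp)) (by
        have f1 : (1 + ((l - s : ℤ) : DualNumber ℤ) * DualNumber.eps) = (1 + ((1 : ℤ) : DualNumber ℤ) * DualNumber.eps) ^ l *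
            (1 + ((-1 : ℤ) : DualNumber ℤ) * DualNumber.eps) ^ s := by
          rw [e1, e4]; push_cast; linear_combination (l * s : DualNumber ℤ) * hee
        have f2 : (1 + ((s - l : ℤ) : DualNumber ℤ) * DualNumber.eps) = (1 + ((1 : ℤ) : DualNumber ℤ) * DualNumber.eps) ^ s *
            (1 + ((-1 : ℤ) : DualNumber ℤ) * DualNumber.eps) ^ l := by
          rw [e3, e2]; push_cast; linear_combination (l * s : DualNumber ℤ) * hee
        rw [f1, f2]
        push_cast
        have g1 : (2 * ((p : DualNumber ℤ) * 1) + -(p : DualNumber ℤ) * (2 * 1 + (-1 + DualNumber.eps)))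
            = -(p : DualNumber ℤ) * (-1) * (1 + -1 * DualNumber.eps) := by ring
        have g2 : (2 * 1 + (-1 + DualNumber.eps) : DualNumber ℤ) = 1 + 1 * DualNumber.eps := by ring
        have g3 : (-1 + DualNumber.eps : DualNumber ℤ) = (-1) * (1 + -1 * DualNumber.eps) := by ring
        rw [g1, g2, g3] at hA
        simp only [mul_pow, one_pow, pow_add] at hA ⊢
        linear_combination hA)
    omega

lemma excl2 {k r l s : ℕ} (hls : 3 ≤ l + s) (hl : 1 ≤ l) (hkr : k ≠ r) {p d : ℤ}
    (hp : p = 1 ∨ p = -1)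
    (h : ∀ x y : DualNumber ℤ, ∃ B, fP k r ((p : DualNumber ℤ) * (x + y)) (-p * y)
      = d * fP k r x y + B * fQ l s x y) : False := by
  apply hkr
  have hp0 : p ≠ 0 := by omega
  by_cases h2 : 2 ≤ l
  · obtain ⟨A, hA⟩ := h 1 DualNumber.eps
    simp only [fP, fQ, eps_pow h2] at hA
    have := dual_cmp (e := p ^ (k + r)) (d := d) (a := k * 1) (b := r * 1)
      (pow_ne_zero _ hp0) (by
        rw [← one_add_eps_pow, ← one_add_eps_pow]
        push_cast
        rw [show (↑p * (1 + DualNumber.eps) + -↑p * DualNumber.eps : DualNumber ℤ) = p by ring] at hA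
        simp only [mul_pow, one_mul, pow_add, one_pow] at hA ⊢
        linear_combination hA)
    omega
  · have hr : 2 ≤ s := by omega
    obtain ⟨A, hA⟩ := h 1 (-2 + DualNumber.eps)
    simp only [fP, fQ] at hA
    rw [show (2 * 1 + (-2 + DualNumber.eps) : DualNumber ℤ) = DualNumber.eps by ring, eps_pow hr,
      show (1 + (-2 + DualNumber.eps) : DualNumber ℤ) = (-1) * (1 + -1 * DualNumber.eps) by ring,
      show (↑p * (-1 * (1 + -1 * DualNumber.eps)) + -↑p * (-2 + DualNumber.eps) : DualNumber ℤ) = p by ring] at hA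
    have := dual_cmp (e := p ^ (k + r) * (-1) ^ k) (d := d * (-1) ^ r) (a := k * (-1)) (b := r * (-1))
      (mul_ne_zero (pow_ne_zero _ hp0) (by simp)) (by
        rw [← one_add_eps_pow, ← one_add_eps_pow]
        push_cast
        simp only [mul_pow, one_pow, pow_add] at hA ⊢
        linear_combination hA)
    omega

def Concl (p q w v : ℤ) : Prop :=
  (p = 1 ∧ q = 0 ∧ w = 0 ∧ v = 1) ∨ (p = -1 ∧ q = 0 ∧ w = 0 ∧ v = -1)

lemma case1 {k r l s : ℕ} (hk : 1 ≤ k) (hr : 1 ≤ r) (hkr3 : 3 ≤ k + r)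
    (hkr : k ≠ r) (hls : l ≠ s) {p q w v c d : ℤ}
    (hdet : p * v - q * w = 1 ∨ p * v - q * w = -1)
    (hP : ∀ x y : ℤ, fP k r (p * x + q * y) (w * x + v * y) = c * fP k r x y)
    (hQ : ∀ x y : DualNumber ℤ, ∃ A, fQ l s (p * x + q * y) (w * x + v * y)
      = A * fP k r x y + d * fQ l s x y) : Concl p q w v := by
  have hk0 : k ≠ 0 := by omega
  have hr0 : r ≠ 0 := by omega
  have h1 := hP 0 1
  have h2 := hP 1 (-1)
  simp [fP, hk0, hr0] at h1 h2
  rcases h1 with h1 | h1 <;> rcases h2 with h2 | h2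
  · exfalso
    have : p = 0 := by linarith
    subst h1; subst this; simp at hdet
  · subst h1
    have hw : w = v - p := by linarith
    subst hw
    obtain ⟨hp, hv⟩ := unit_mul_cases (a := p) (b := v) (by simpa using hdet)
    by_cases hpv : v = p
    · unfold Concl; omega
    · exfalso
      have : v = -p := by omega
      subst this
      refine excl1 (l := l) (s := s) (d := d) hkr3 hk hls hp fun x y => ?_
      obtain ⟨A, hA⟩ := hQ x y
      refine ⟨A, ?_⟩
      rw [← hA]; congr 1 <;> push_cast <;> ring
  · exfalso
    have hv : v = -q := by linarith
    have hp : p = q := by linarith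
    subst hv; subst hp
    obtain ⟨h3, h4⟩ := unit_mul_cases (a := p) (b := p + w) (by
      rcases hdet with h | h
      · right; linarith
      · left; linarith)
    have h5 := hP 1 0
    have h6 := hP 1 1
    simp [fP] at h5 h6
    have h7 : (2 : ℤ) ^ k = 2 ^ r := by
      have h8 : (p ^ k * (p + w) ^ r) * 2 ^ k = (p ^ k * (p + w) ^ r) * 2 ^ r := by
        rw [h5]
        rw [← h6, ← h5, ← two_mul, mul_pow]
        ring
      refine mul_left_cancel₀ ?_ h8
      apply mul_ne_zero <;> apply pow_ne_zero <;> omega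
    exact hkr (Int.pow_right_injective (le_refl 2) h7)
  · exfalso
    have hv : v = -q := by linarith
    have hw : w = -p := by linarith
    subst hv; subst hw
    have : p * -q - q * -p = 0 := by ring
    omega

lemma case2 {k r l s : ℕ} (hl : 1 ≤ l) (hs : 1 ≤ s) (hls3 : 3 ≤ l + s)
    (hkr : k ≠ r) (hls : l ≠ s) {p q w v c d : ℤ}
    (hdet : p * v - q * w = 1 ∨ p * v - q * w = -1)
    (hQ : ∀ x y : ℤ, fQ l s (p * x + q * y) (w * x + v * y) = c * fQ l s x y)
    (hP : ∀ x y : DualNumber ℤ, ∃ B, fP k r (p * x + q * y) (w * x + v * y)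
      = d * fP k r x y + B * fQ l s x y) : Concl p q w v := by
  have hk0 : l ≠ 0 := by omega
  have hr0 : s ≠ 0 := by omega
  have h1 := hQ 1 0
  have h2 := hQ 1 (-2)
  simp [fQ, hk0, hr0] at h1 h2
  rcases h1 with h1 | h1 <;> rcases h2 with h2 | h2
  · exfalso
    have : v = 0 := by linarith
    subst h1; subst this; simp at hdet
  · subst h1
    have hw : p = v + 2 * q := by linarith
    obtain ⟨hp, hv⟩ := unit_mul_cases (a := p) (b := v) (by simpa using hdet)
    by_cases hpv : v = p
    · unfold Concl; omega
    · exfalso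
      have : v = -p := by omega
      have hq : q = p := by omega
      subst this; subst hq
      refine excl2 (k := k) (r := r) (d := d) hls3 hl hkr hp fun x y => ?_
      obtain ⟨A, hA⟩ := hP x y
      refine ⟨A, ?_⟩
      rw [← hA]; congr 1 <;> push_cast <;> ring
  · exfalso
    have hp : p = -v := by linarith
    have hw : w = 2 * v := by linarith
    subst hp; subst hw
    obtain ⟨h3, h4⟩ := unit_mul_cases (a := v) (b := v + 2 * q) (by
      rcases hdet with h | h
      · right; linarith
      · left; linarith)
    have h5 := hQ 0 1
    have h6 := hQ 1 1
    simp [fQ] at h5 h6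
    have h7 : (3 : ℤ) ^ l = 3 ^ s := by
      have h8 : (v ^ l * (2 * q + v) ^ s) * 3 ^ l = (v ^ l * (2 * q + v) ^ s) * 3 ^ s := by
        rw [h5]
        rw [← h6, ← h5, show 2 * v + v = v * 3 by ring, mul_pow,
          show 2 * (-v + q) + v * 3 = 2 * q + v by ring]
        ring
      refine mul_left_cancel₀ ?_ h8
      apply mul_ne_zero <;> apply pow_ne_zero <;> omega
    exact hls (Int.pow_right_injective (by norm_num) h7)
  · exfalso
    have hv : v = -2 * q := by linarith
    have hw : w = -2 * p := by linarith
    subst hv; subst hw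
    have : p * (-2 * q) - q * (-2 * p) = 0 := by ring
    omega

lemma case3a {k r l s : ℕ} (hl : 1 ≤ l) (hs : 1 ≤ s) {p q w v c : ℤ}
    (hdet : p * v - q * w = 1 ∨ p * v - q * w = -1)
    (hP : ∀ x y : ℤ, fP k r (p * x + q * y) (w * x + v * y) = c * fQ l s x y) : False := by
  have hk0 : l ≠ 0 := by omega
  have hr0 : s ≠ 0 := by omega
  have h1 := hP 1 0
  have h2 := hP 1 (-2)
  simp [fQ, fP, hk0, hr0] at h1 h2
  rcases h1 with ⟨h1, -⟩ | ⟨h1, -⟩ <;> rcases h2 with ⟨h2, -⟩ | ⟨h2, -⟩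
  · have : q = 0 := by omega
    subst h1 this; simp at hdet
  · have : w = 2 * q + 2 * v := by linarith
    subst h1 this
    have : 0 * v - q * (2 * q + 2 * v) = 2 * (-q * (q + v)) := by ring
    omega
  · have h3 : p = 2 * q := by linarith
    have h4 : w = - (2 * q) := by linarith
    subst h3 h4
    have : 2 * q * v - q * -(2 * q) = 2 * (q * (q + v)) := by ring
    omega
  · have h3 : v = -q := by linarith
    have h4 : w = - p := by linarith
    subst h3 h4
    have : p * -q - q * -p = 0 := by ring
    omega

lemma abc_excl {k r l s : ℕ} (h5 : 5 ≤ k + r) {p q w v α β : ℤ}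
    (hdet : p * v - q * w = 1 ∨ p * v - q * w = -1)
    (hP : ∀ x y : Polynomial ℚ, fP k r (p * x + q * y) (w * x + v * y)
      = α * fP k r x y + β * fQ l s x y) : α = 0 ∨ β = 0 := by
  by_contra hcon
  push Not at hcon
  obtain ⟨hα, hβ⟩ := hcon
  have h := hP Polynomial.X 1
  simp only [fP, fQ, one_pow, one_mul, mul_one] at h
  set X : Polynomial ℚ := Polynomial.X with hX
  have lin_ne : ∀ a b : ℤ, (a ≠ 0 ∨ b ≠ 0) → (a * X + b : Polynomial ℚ) ≠ 0 := by
    intro a b hab h0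
    have h1 := congrArg (Polynomial.eval 0) h0
    have h2 := congrArg (Polynomial.eval 1) h0
    simp [hX] at h1 h2
    rw [h1] at h2
    simp at h2
    have : a = 0 := by exact_mod_cast h2
    omega
  have lin_deg : ∀ a b : ℤ, (a * X + b : Polynomial ℚ).natDegree ≤ 1 := by
    intro a b
    have := Polynomial.natDegree_linear_le (a := (a : ℚ)) (b := (b : ℚ))
    simpa using this
  have n1 : X ≠ 0 := Polynomial.X_ne_zero
  have n2 : X + 1 ≠ 0 := by simpa using lin_ne 1 1 (by simp)
  have n3 : 2 * X + 1 ≠ 0 := by simpa using lin_ne 2 1 (by simp)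
  have n4 : (p * X + q : Polynomial ℚ) ≠ 0 := lin_ne p q (by
    by_contra hh; push Not at hh; rw [hh.1, hh.2] at hdet; simp at hdet)
  have n5 : (p * X + q + (w * X + v) : Polynomial ℚ) ≠ 0 := by
    have := lin_ne (p + w) (q + v) (by
      by_contra hh; push Not at hh
      have h1 : w = -p := by omega
      have h2 : v = -q := by omega
      rw [h1, h2] at hdet; ring_nf at hdet; omega)
    intro h0
    apply this
    rw [← h0]; push_cast; ring
  have nα : (α : Polynomial ℚ) ≠ 0 := by exact_mod_cast hα
  have nβ : (β : Polynomial ℚ) ≠ 0 := by exact_mod_cast hβ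
  have uα : IsUnit (α : Polynomial ℚ) := by
    have : (α : Polynomial ℚ) = Polynomial.C (α : ℚ) := by simp
    rw [this, Polynomial.isUnit_C]; exact isUnit_iff_ne_zero.2 (by exact_mod_cast hα)
  have uβ : IsUnit (β : Polynomial ℚ) := by
    have : (β : Polynomial ℚ) = Polynomial.C (β : ℚ) := by simp
    rw [this, Polynomial.isUnit_C]; exact isUnit_iff_ne_zero.2 (by exact_mod_cast hβ)
  set a : Polynomial ℚ := α * (X ^ k * (X + 1) ^ r) with ha
  set b : Polynomial ℚ := β * (2 * X + 1) ^ s with hb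
  set c : Polynomial ℚ := -((p * X + q) ^ k * (p * X + q + (w * X + v)) ^ r) with hc
  have a0 : a ≠ 0 := mul_ne_zero nα (mul_ne_zero (pow_ne_zero _ n1) (pow_ne_zero _ n2))
  have b0 : b ≠ 0 := mul_ne_zero nβ (pow_ne_zero _ n3)
  have c0 : c ≠ 0 := neg_ne_zero.2 (mul_ne_zero (pow_ne_zero _ n4) (pow_ne_zero _ n5))
  have hcop : IsCoprime a b := by
    rw [ha, hb]
    rw [isCoprime_mul_unit_left_left uα, isCoprime_mul_unit_left_right uβ]
    apply IsCoprime.mul_left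
    · apply IsCoprime.pow
      exact ⟨-2, 1, by ring⟩
    · apply IsCoprime.pow
      exact ⟨2, -1, by ring⟩
  have hsum : a + b + c = 0 := by rw [hc, h]; ring
  have dega : a.natDegree = k + r := by
    rw [ha, Polynomial.natDegree_mul nα (mul_ne_zero (pow_ne_zero _ n1) (pow_ne_zero _ n2)),
      Polynomial.natDegree_mul (pow_ne_zero _ n1) (pow_ne_zero _ n2), Polynomial.natDegree_pow,
      Polynomial.natDegree_pow, Polynomial.natDegree_intCast]
    have : (X + 1).natDegree = 1 := by
      have := Polynomial.natDegree_X_add_C (1 : ℚ)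
      simpa using this
    rw [this]; simp [hX]
  rcases Polynomial.abc a0 b0 c0 hcop hsum with ⟨h1, -, -⟩ | ⟨h1, -, -⟩
  · set T : Polynomial ℚ := X * (X + 1) * (2 * X + 1) * (p * X + q) * (p * X + q + (w * X + v)) with hT
    have hT0 : T ≠ 0 := by
      rw [hT]; exact mul_ne_zero (mul_ne_zero (mul_ne_zero (mul_ne_zero n1 n2) n3) n4) n5
    have hdvd : UniqueFactorizationMonoid.radical (a * b * c) ∣ T := by
      rw [← UniqueFactorizationMonoid.exists_dvd_pow_iff_radical_dvd (mul_ne_zero (mul_ne_zero a0 b0) c0)]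
      refine ⟨k + r + s, ?_⟩
      have key : a * b * c ∣ (α * β : Polynomial ℚ) * T ^ (k + r + s) := by
        refine ⟨-(X ^ (r + s) * (X + 1) ^ (k + s) * (2 * X + 1) ^ (k + r) * (p * X + q) ^ (r + s)
          * (p * X + q + (w * X + v)) ^ (k + s)), ?_⟩
        rw [ha, hb, hc, hT]
        simp only [mul_pow, pow_add]
        generalize (p * X + q + (w * X + v) : Polynomial ℚ) = V
        generalize (p * X + q : Polynomial ℚ) = U
        generalize (X + 1 : Polynomial ℚ) = W
        generalize (2 * X + 1 : Polynomial ℚ) = Z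
        ring
      exact (IsUnit.dvd_mul_left (uα.mul uβ)).1 key
    have hle := Polynomial.natDegree_le_of_dvd hdvd hT0
    have hTd : T.natDegree ≤ 5 := by
      have e1 : X.natDegree ≤ 1 := by simp [hX]
      have e2 : (X + 1).natDegree ≤ 1 := by simpa using lin_deg 1 1
      have e3 : (2 * X + 1).natDegree ≤ 1 := by simpa using lin_deg 2 1
      have e4 := lin_deg p q
      have e5 : (p * X + q + (w * X + v) : Polynomial ℚ).natDegree ≤ 1 := by
        have := lin_deg (p + w) (q + v)
        rwa [show ((p + w : ℤ) * X + (q + v : ℤ) : Polynomial ℚ) = (p * X + q + (w * X + v)) by push_cast; ring] at this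
      exact Polynomial.natDegree_mul_le_of_le (m := 4) (n := 1) (Polynomial.natDegree_mul_le_of_le (m := 3) (n := 1)
        (Polynomial.natDegree_mul_le_of_le (m := 2) (n := 1) (Polynomial.natDegree_mul_le_of_le (m := 1) (n := 1) e1 e2) e3) e4) e5
    omega
  · have := Polynomial.derivative_eq_zero.1 h1
    omega

lemma dual_cross {t u u' : DualNumber ℤ} {b d : ℤ} (h : u = b * t) (h' : u' = d * t) :
    u.fst * u'.snd = u.snd * u'.fst := by
  subst h h'
  simp
  ring

lemma quad_zero {A B C a b : ℤ} (hA : 0 < A) (hd : B ^ 2 < 4 * A * C)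
    (h : A * a ^ 2 + B * (a * b) + C * b ^ 2 = 0) : a = 0 ∧ b = 0 := by
  have h1 : (2 * A * a + B * b) ^ 2 + (4 * A * C - B ^ 2) * b ^ 2 = 0 := by
    linear_combination (4 * A) * h
  have h2 : 0 < 4 * A * C - B ^ 2 := by linarith
  have hb : b = 0 := by
    by_contra hb
    have : 0 < b ^ 2 := by positivity
    have := mul_pos h2 this
    nlinarith [sq_nonneg (2 * A * a + B * b)]
  subst hb
  refine ⟨?_, rfl⟩
  have : A * a ^ 2 = 0 := by linarith
  rcases mul_eq_zero.1 this with h | h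
  · omega
  · exact pow_eq_zero_iff (two_ne_zero) |>.1 h

lemma crit {k r l s : ℕ} (hN : k + r = l + s) {a a' b b' : ℤ}
    (hdisc : (3 * (k + r + 2 : ℤ) - 2 * (r + 1) - 2 * (s + 1)) ^ 2 < 4 * (2 * (l + 1)) * (k + 1))
    (hab : a * b' - a' * b ≠ 0)
    {t : DualNumber ℤ} {β δ : ℤ}
    (h : fP (k+1) (r+1) ((a : DualNumber ℤ) + (a' : DualNumber ℤ) * DualNumber.eps) ((b : DualNumber ℤ) + (b' : DualNumber ℤ) * DualNumber.eps) = β * t)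
    (h' : fQ (l+1) (s+1) ((a : DualNumber ℤ) + (a' : DualNumber ℤ) * DualNumber.eps) ((b : DualNumber ℤ) + (b' : DualNumber ℤ) * DualNumber.eps) = δ * t) :
    a ^ k * (a + b) ^ r * (b ^ l * (2 * a + b) ^ s) = 0 := by
  have hc := dual_cross h h'
  have f2 : (2 : DualNumber ℤ).fst = 2 := rfl
  have s2 : (2 : DualNumber ℤ).snd = 0 := rfl
  simp [fP, fQ, f2, s2] at hc
  have hNz : (k : ℤ) + r = l + s := by exact_mod_cast hN
  have hr : (r : ℤ) = l + s - k := by linarith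
  have key : ((a * b' - a' * b) * ((a ^ k * (a + b) ^ r * (b ^ l * (2 * a + b) ^ s)) *
    ((2 * (l + 1)) * a ^ 2 + (3 * (k + r + 2 : ℤ) - 2 * (r + 1) - 2 * (s + 1)) * (a * b) + (k + 1) * b ^ 2))) = 0 := by
    simp only [pow_succ] at hc
    generalize a ^ k = A at *
    generalize (a + b) ^ r = B at *
    generalize b ^ l = C at *
    generalize (2 * a + b) ^ s = D at *
    rw [hr] at hc ⊢
    linear_combination hc
  have h1 := (mul_eq_zero.1 key).resolve_left hab
  rcases mul_eq_zero.1 h1 with h2 | h2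
  · exact h2
  · obtain ⟨ha, hb⟩ := quad_zero (by positivity) hdisc h2
    subst ha hb
    simp at hab

lemma small {k r l s : ℕ} (hN : k + r = l + s)
    (hN2 : k + r = 1 ∨ k + r = 2) (hkr : k ≠ r) (hls : l ≠ s) {p q w v α β γ δ : ℤ}
    (hdet : p * v - q * w = 1 ∨ p * v - q * w = -1)
    (hPz : ∀ x y : ℤ, fP (k+1) (r+1) (p * x + q * y) (w * x + v * y)
      = α * fP (k+1) (r+1) x y + β * fQ (l+1) (s+1) x y)
    (hP : ∀ x y : DualNumber ℤ, fP (k+1) (r+1) (p * x + q * y) (w * x + v * y)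
      = α * fP (k+1) (r+1) x y + β * fQ (l+1) (s+1) x y)
    (hQ : ∀ x y : DualNumber ℤ, fQ (l+1) (s+1) (p * x + q * y) (w * x + v * y)
      = γ * fP (k+1) (r+1) x y + δ * fQ (l+1) (s+1) x y) : Concl p q w v := by
  have hkl : ((k = 0 ∧ r ≠ 0) ∨ (k ≠ 0 ∧ r = 0)) := by omega
  have hll : ((l = 0 ∧ s ≠ 0) ∨ (l ≠ 0 ∧ s = 0)) := by omega
  have hdisc : (3 * (k + r + 2 : ℤ) - 2 * (r + 1) - 2 * (s + 1)) ^ 2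
      < 4 * (2 * (l + 1)) * (k + 1) := by
    have : k ≤ 2 := by omega
    have : r ≤ 2 := by omega
    have : l ≤ 2 := by omega
    have : s ≤ 2 := by omega
    interval_cases k <;> interval_cases r <;> interval_cases l <;> interval_cases s <;>
      omega
  have hdet0 : p * v - q * w ≠ 0 := by omega
  -- critical point of `P`
  have critP : ∀ x y x' y' : ℤ, (x * y' - x' * y = 1 ∨ x * y' - x' * y = -1) →
      fP (k+1) (r+1) ((x : DualNumber ℤ) + (x' : DualNumber ℤ) * DualNumber.eps)
        ((y : DualNumber ℤ) + (y' : DualNumber ℤ) * DualNumber.eps) = 0 ∨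
      fQ (l+1) (s+1) ((x : DualNumber ℤ) + (x' : DualNumber ℤ) * DualNumber.eps)
        ((y : DualNumber ℤ) + (y' : DualNumber ℤ) * DualNumber.eps) = 0 →
      (p * x + q * y) ^ k * ((p * x + q * y) + (w * x + v * y)) ^ r *
        ((w * x + v * y) ^ l * (2 * (p * x + q * y) + (w * x + v * y)) ^ s) = 0 := by
    intro x y x' y' hxy h0
    have h1 := hP ((x : DualNumber ℤ) + (x' : DualNumber ℤ) * DualNumber.eps)
        ((y : DualNumber ℤ) + (y' : DualNumber ℤ) * DualNumber.eps)
    have h2 := hQ ((x : DualNumber ℤ) + (x' : DualNumber ℤ) * DualNumber.eps)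
        ((y : DualNumber ℤ) + (y' : DualNumber ℤ) * DualNumber.eps)
    have e1 : (p : DualNumber ℤ) * ((x : DualNumber ℤ) + (x' : DualNumber ℤ) * DualNumber.eps)
      + (q : DualNumber ℤ) * ((y : DualNumber ℤ) + (y' : DualNumber ℤ) * DualNumber.eps) =
      ((p * x + q * y : ℤ) : DualNumber ℤ) + ((p * x' + q * y' : ℤ) : DualNumber ℤ) * DualNumber.eps := by
      push_cast; ring
    have e2 : (w : DualNumber ℤ) * ((x : DualNumber ℤ) + (x' : DualNumber ℤ) * DualNumber.eps)
      + (v : DualNumber ℤ) * ((y : DualNumber ℤ) + (y' : DualNumber ℤ) * DualNumber.eps) =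
      ((w * x + v * y : ℤ) : DualNumber ℤ) + ((w * x' + v * y' : ℤ) : DualNumber ℤ) * DualNumber.eps := by
      push_cast; ring
    rw [e1, e2] at h1 h2
    have hne : (p * x + q * y) * (w * x' + v * y') - (p * x' + q * y') * (w * x + v * y) ≠ 0 := by
      have : (p * x + q * y) * (w * x' + v * y') - (p * x' + q * y') * (w * x + v * y)
        = (p * v - q * w) * (x * y' - x' * y) := by ring
      rw [this]
      exact mul_ne_zero hdet0 (by omega)
    rcases h0 with h0 | h0
    · rw [h0, mul_zero, zero_add] at h1 h2
      exact crit hN hdisc hne h1 h2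
    · rw [h0, mul_zero, add_zero] at h1 h2
      exact crit hN hdisc hne h1 h2
  have z1 := hPz 1 0
  have z2 := hPz 0 1
  have z3 := hPz 1 (-1)
  have z4 := hPz 1 1
  have z5 := hPz 1 (-2)
  rcases hkl with ⟨hk, hr⟩ | ⟨hk, hr⟩ <;> rcases hll with ⟨hl, hs⟩ | ⟨hl, hs⟩
  · have c1 := critP 1 (-1) 0 1 (by simp) (by left; simp [fP, hk, eps_pow (k := r + 1) (by omega)])
    have c2 := critP 1 (-2) 0 1 (by simp) (by right; simp [fQ, hl, eps_pow (k := s + 1) (by omega)])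
    simp [hk, hr, hl, hs] at c1 c2
    have hklrs : (k = 0 ∧ r = 1 ∧ l = 0 ∧ s = 1) ∨ (k = 0 ∧ r = 2 ∧ l = 0 ∧ s = 2) := by omega
    clear hP hQ critP hdisc hPz
    rcases c1 with c1 | c1 <;> rcases c2 with c2 | c2
    · exfalso
      have h1 : w = -p := by omega
      have h2 : v = -q := by omega
      rw [h1, h2] at hdet
      ring_nf at hdet
      omega
    · obtain ⟨e, he⟩ : ∃ e, e = p + w := ⟨_, rfl⟩
      obtain ⟨f, hf⟩ : ∃ f, f = 2 * q + v := ⟨_, rfl⟩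
      obtain rfl : p = (-1) * e + (2) * f := by omega
      obtain rfl : q = (-1) * e + (1) * f := by omega
      obtain rfl : w = (2) * e + (-2) * f := by omega
      obtain rfl : v = (2) * e + (-1) * f := by omega
      obtain ⟨h1, h2⟩ := unit_mul_cases (a := e) (b := f) (by ring_nf at hdet ⊢; omega)
      rcases hklrs with ⟨rfl, rfl, rfl, rfl⟩ | ⟨rfl, rfl, rfl, rfl⟩ <;>
      rcases h1 with rfl | rfl <;> rcases h2 with rfl | rfl <;>
      norm_num [fP, fQ] at z1 z2 z3 z4 z5 <;> first | omega | (unfold Concl; norm_num)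
    · obtain ⟨e, he⟩ : ∃ e, e = q + v := ⟨_, rfl⟩
      obtain ⟨f, hf⟩ : ∃ f, f = 2 * p + w := ⟨_, rfl⟩
      obtain rfl : p = (-2) * e + (1) * f := by omega
      obtain rfl : q = (-1) * e + (1) * f := by omega
      obtain rfl : w = (4) * e + (-1) * f := by omega
      obtain rfl : v = (2) * e + (-1) * f := by omega
      obtain ⟨h1, h2⟩ := unit_mul_cases (a := e) (b := f) (by ring_nf at hdet ⊢; omega)
      rcases hklrs with ⟨rfl, rfl, rfl, rfl⟩ | ⟨rfl, rfl, rfl, rfl⟩ <;>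
      rcases h1 with rfl | rfl <;> rcases h2 with rfl | rfl <;>
      norm_num [fP, fQ] at z1 z2 z3 z4 z5 <;> first | omega | (unfold Concl; norm_num)
    · exfalso
      have h1 : w = -(2 * p) := by omega
      have h2 : v = -(2 * q) := by omega
      rw [h1, h2] at hdet
      ring_nf at hdet
      omega
  · have c1 := critP 1 (-1) 0 1 (by simp) (by left; simp [fP, hk, eps_pow (k := r + 1) (by omega)])
    have c2 := critP 1 0 0 1 (by simp) (by right; simp [fQ, hs, eps_pow (k := l + 1) (by omega)])
    simp [hk, hr, hl, hs] at c1 c2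
    have hklrs : (k = 0 ∧ r = 1 ∧ l = 1 ∧ s = 0) ∨ (k = 0 ∧ r = 2 ∧ l = 2 ∧ s = 0) := by omega
    clear hP hQ critP hdisc hPz
    rcases c1 with c1 | c1 <;> rcases c2 with c2 | c2
    · exfalso
      have h1 : w = -p := by omega
      have h2 : v = -q := by omega
      rw [h1, h2] at hdet
      ring_nf at hdet
      omega
    · obtain ⟨e, he⟩ : ∃ e, e = p + w := ⟨_, rfl⟩
      obtain ⟨f, hf⟩ : ∃ f, f = v := ⟨_, rfl⟩
      obtain rfl : p = (1) * e := by omega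
      obtain rfl : q = (1) * e + (-1) * f := by omega
      obtain rfl : w = 0 := by omega
      obtain rfl : v = (1) * f := by omega
      obtain ⟨h1, h2⟩ := unit_mul_cases (a := e) (b := f) (by ring_nf at hdet ⊢; omega)
      rcases hklrs with ⟨rfl, rfl, rfl, rfl⟩ | ⟨rfl, rfl, rfl, rfl⟩ <;>
      rcases h1 with rfl | rfl <;> rcases h2 with rfl | rfl <;>
      norm_num [fP, fQ] at z1 z2 z3 z4 z5 <;> first | omega | (unfold Concl; norm_num)
    · obtain ⟨e, he⟩ : ∃ e, e = q + v := ⟨_, rfl⟩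
      obtain ⟨f, hf⟩ : ∃ f, f = w := ⟨_, rfl⟩
      obtain rfl : p = (-1) * f := by omega
      obtain rfl : q = (1) * e + (-1) * f := by omega
      obtain rfl : w = (1) * f := by omega
      obtain rfl : v = (1) * f := by omega
      obtain ⟨h1, h2⟩ := unit_mul_cases (a := e) (b := f) (by ring_nf at hdet ⊢; omega)
      rcases hklrs with ⟨rfl, rfl, rfl, rfl⟩ | ⟨rfl, rfl, rfl, rfl⟩ <;>
      rcases h1 with rfl | rfl <;> rcases h2 with rfl | rfl <;>
      norm_num [fP, fQ] at z1 z2 z3 z4 z5 <;> first | omega | (unfold Concl; norm_num)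
    · exfalso
      have h1 : w = 0 := by omega
      have h2 : v = 0 := by omega
      rw [h1, h2] at hdet
      ring_nf at hdet
      omega
  · have c1 := critP 0 1 1 0 (by simp) (by left; simp [fP, hr, eps_pow (k := k + 1) (by omega)])
    have c2 := critP 1 (-2) 0 1 (by simp) (by right; simp [fQ, hl, eps_pow (k := s + 1) (by omega)])
    simp [hk, hr, hl, hs] at c1 c2
    have hklrs : (k = 1 ∧ r = 0 ∧ l = 0 ∧ s = 1) ∨ (k = 2 ∧ r = 0 ∧ l = 0 ∧ s = 2) := by omega
    clear hP hQ critP hdisc hPz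
    rcases c1 with c1 | c1 <;> rcases c2 with c2 | c2
    · exfalso
      have h1 : p = 0 := by omega
      have h2 : q = 0 := by omega
      rw [h1, h2] at hdet
      ring_nf at hdet
      omega
    · obtain ⟨e, he⟩ : ∃ e, e = p := ⟨_, rfl⟩
      obtain ⟨f, hf⟩ : ∃ f, f = 2 * q + v := ⟨_, rfl⟩
      obtain rfl : p = (1) * e := by omega
      obtain rfl : q = 0 := by omega
      obtain rfl : w = (-2) * e + (2) * f := by omega
      obtain rfl : v = (1) * f := by omega
      obtain ⟨h1, h2⟩ := unit_mul_cases (a := e) (b := f) (by ring_nf at hdet ⊢; omega)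
      rcases hklrs with ⟨rfl, rfl, rfl, rfl⟩ | ⟨rfl, rfl, rfl, rfl⟩ <;>
      rcases h1 with rfl | rfl <;> rcases h2 with rfl | rfl <;>
      norm_num [fP, fQ] at z1 z2 z3 z4 z5 <;> first | omega | (unfold Concl; norm_num)
    · obtain ⟨e, he⟩ : ∃ e, e = q := ⟨_, rfl⟩
      obtain ⟨f, hf⟩ : ∃ f, f = 2 * p + w := ⟨_, rfl⟩
      obtain rfl : p = (2) * e := by omega
      obtain rfl : q = (1) * e := by omega
      obtain rfl : w = (-4) * e + (1) * f := by omega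
      obtain rfl : v = (-2) * e := by omega
      obtain ⟨h1, h2⟩ := unit_mul_cases (a := e) (b := f) (by ring_nf at hdet ⊢; omega)
      rcases hklrs with ⟨rfl, rfl, rfl, rfl⟩ | ⟨rfl, rfl, rfl, rfl⟩ <;>
      rcases h1 with rfl | rfl <;> rcases h2 with rfl | rfl <;>
      norm_num [fP, fQ] at z1 z2 z3 z4 z5 <;> first | omega | (unfold Concl; norm_num)
    · exfalso
      have h1 : w = -(2 * p) := by omega
      have h2 : v = -(2 * q) := by omega
      rw [h1, h2] at hdet
      ring_nf at hdet
      omega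
  · have c1 := critP 0 1 1 0 (by simp) (by left; simp [fP, hr, eps_pow (k := k + 1) (by omega)])
    have c2 := critP 1 0 0 1 (by simp) (by right; simp [fQ, hs, eps_pow (k := l + 1) (by omega)])
    simp [hk, hr, hl, hs] at c1 c2
    have hklrs : (k = 1 ∧ r = 0 ∧ l = 1 ∧ s = 0) ∨ (k = 2 ∧ r = 0 ∧ l = 2 ∧ s = 0) := by omega
    clear hP hQ critP hdisc hPz
    rcases c1 with c1 | c1 <;> rcases c2 with c2 | c2
    · exfalso
      have h1 : p = 0 := by omega
      have h2 : q = 0 := by omega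
      rw [h1, h2] at hdet
      ring_nf at hdet
      omega
    · obtain ⟨e, he⟩ : ∃ e, e = p := ⟨_, rfl⟩
      obtain ⟨f, hf⟩ : ∃ f, f = v := ⟨_, rfl⟩
      obtain rfl : p = (1) * e := by omega
      obtain rfl : q = 0 := by omega
      obtain rfl : w = 0 := by omega
      obtain rfl : v = (1) * f := by omega
      obtain ⟨h1, h2⟩ := unit_mul_cases (a := e) (b := f) (by ring_nf at hdet ⊢; omega)
      rcases hklrs with ⟨rfl, rfl, rfl, rfl⟩ | ⟨rfl, rfl, rfl, rfl⟩ <;>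
      rcases h1 with rfl | rfl <;> rcases h2 with rfl | rfl <;>
      norm_num [fP, fQ] at z1 z2 z3 z4 z5 <;> first | omega | (unfold Concl; norm_num)
    · obtain ⟨e, he⟩ : ∃ e, e = q := ⟨_, rfl⟩
      obtain ⟨f, hf⟩ : ∃ f, f = w := ⟨_, rfl⟩
      obtain rfl : p = 0 := by omega
      obtain rfl : q = (1) * e := by omega
      obtain rfl : w = (1) * f := by omega
      obtain rfl : v = 0 := by omega
      obtain ⟨h1, h2⟩ := unit_mul_cases (a := e) (b := f) (by ring_nf at hdet ⊢; omega)
      rcases hklrs with ⟨rfl, rfl, rfl, rfl⟩ | ⟨rfl, rfl, rfl, rfl⟩ <;>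
      rcases h1 with rfl | rfl <;> rcases h2 with rfl | rfl <;>
      norm_num [fP, fQ] at z1 z2 z3 z4 z5 <;> first | omega | (unfold Concl; norm_num)
    · exfalso
      have h1 : w = 0 := by omega
      have h2 : v = 0 := by omega
      rw [h1, h2] at hdet
      ring_nf at hdet
      omega

section
attribute [local instance] MvPolynomial.gradedAlgebra
lemma hc_mul_le {A P : MvPolynomial (Fin 2) ℤ} {D N : ℕ} (hP : P.IsHomogeneous D) (h : D ≤ N) :
    homogeneousComponent N (A * P) = homogeneousComponent (N - D) A * P := by
  have := DirectSum.coe_decompose_mul_of_right_mem_of_le (homogeneousSubmodule (Fin 2) ℤ)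
    (a := A) (b := P) hP h
  simp only [← decomposition.decompose'_apply]
  exact this
lemma hc_mul_not_le {A P : MvPolynomial (Fin 2) ℤ} {D N : ℕ} (hP : P.IsHomogeneous D) (h : ¬ D ≤ N) :
    homogeneousComponent N (A * P) = 0 := by
  have := DirectSum.coe_decompose_mul_of_right_mem_of_not_le (homogeneousSubmodule (Fin 2) ℤ)
    (a := A) (b := P) hP h
  simp only [← decomposition.decompose'_apply]
  exact this
end

lemma fP_map {S T : Type} [CommRing S] [CommRing T] (f : S →+* T) (k r : ℕ) (x y : S) :
    f (fP k r x y) = fP k r (f x) (f y) := by simp [fP]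
lemma fQ_map {S T : Type} [CommRing S] [CommRing T] (f : S →+* T) (k r : ℕ) (x y : S) :
    f (fQ k r x y) = fQ k r (f x) (f y) := by simp [fQ, map_ofNat]

lemma lin_hom (p q : ℤ) : ((p : MvPolynomial (Fin 2) ℤ) * X 0 + (q : MvPolynomial (Fin 2) ℤ) * X 1).IsHomogeneous 1 := by
  have h1 : ((p : MvPolynomial (Fin 2) ℤ) * X 0).IsHomogeneous 1 := by
    have := (isHomogeneous_C (Fin 2) p).mul (isHomogeneous_X ℤ (0 : Fin 2))
    simpa using this
  have h2 : ((q : MvPolynomial (Fin 2) ℤ) * X 1).IsHomogeneous 1 := by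
    have := (isHomogeneous_C (Fin 2) q).mul (isHomogeneous_X ℤ (1 : Fin 2))
    simpa using this
  exact h1.add h2

lemma fP_hom {x y : MvPolynomial (Fin 2) ℤ} (hx : x.IsHomogeneous 1) (hy : y.IsHomogeneous 1)
    (k r : ℕ) : (fP k r x y).IsHomogeneous (k + r) := by
  have := (hx.pow k).mul ((hx.add hy).pow r)
  simpa [fP] using this
lemma fQ_hom {x y : MvPolynomial (Fin 2) ℤ} (hx : x.IsHomogeneous 1) (hy : y.IsHomogeneous 1)
    (k r : ℕ) : (fQ k r x y).IsHomogeneous (k + r) := by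
  have h2 : (2 * x).IsHomogeneous 1 := by
    rw [two_mul]; exact hx.add hx
  have := (hy.pow k).mul ((h2.add hy).pow r)
  simpa [fQ] using this

lemma core {k r l s : ℕ} (hk : 1 ≤ k) (hr : 1 ≤ r) (hl : 1 ≤ l) (hs : 1 ≤ s)
    (hkr3 : 3 ≤ k + r) (hls3 : 3 ≤ l + s) (hkr : k ≠ r) (hls : l ≠ s) {p q w v : ℤ}
    (hdet : p * v - q * w = 1 ∨ p * v - q * w = -1)
    {A B A' B' : MvPolynomial (Fin 2) ℤ}
    (hP : fP k r ((p : MvPolynomial (Fin 2) ℤ) * X 0 + (q : MvPolynomial (Fin 2) ℤ) * X 1)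
        ((w : MvPolynomial (Fin 2) ℤ) * X 0 + (v : MvPolynomial (Fin 2) ℤ) * X 1)
      = A * fP k r (X 0) (X 1) + B * fQ l s (X 0) (X 1))
    (hQ : fQ l s ((p : MvPolynomial (Fin 2) ℤ) * X 0 + (q : MvPolynomial (Fin 2) ℤ) * X 1)
        ((w : MvPolynomial (Fin 2) ℤ) * X 0 + (v : MvPolynomial (Fin 2) ℤ) * X 1)
      = A' * fP k r (X 0) (X 1) + B' * fQ l s (X 0) (X 1)) : Concl p q w v := by
  have hX0 := isHomogeneous_X ℤ (0 : Fin 2)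
  have hX1 := isHomogeneous_X ℤ (1 : Fin 2)
  have hp := lin_hom p q
  have hw := lin_hom w v
  have hP1 := congrArg (homogeneousComponent (k + r)) hP
  have hQ1 := congrArg (homogeneousComponent (l + s)) hQ
  rw [homogeneousComponent_of_mem (fP_hom hp hw k r), if_pos rfl, map_add,
    hc_mul_le (fP_hom hX0 hX1 k r) le_rfl, Nat.sub_self, homogeneousComponent_zero] at hP1
  rw [homogeneousComponent_of_mem (fQ_hom hp hw l s), if_pos rfl, map_add,
    hc_mul_le (fQ_hom hX0 hX1 l s) le_rfl, Nat.sub_self, homogeneousComponent_zero] at hQ1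
  have ev : ∀ {S : Type} [CommRing S] (x y : S) {F G : MvPolynomial (Fin 2) ℤ}, F = G →
    aeval (![x, y]) F = aeval ![x, y] G := by
    intro S _ x y F G h; rw [h]
  have mP : ∀ {S : Type} [CommRing S] (x y : S) (F G : MvPolynomial (Fin 2) ℤ),
    aeval (![x, y]) (fP k r F G) = fP k r (aeval (![x, y]) F) (aeval (![x, y]) G) := by
    intro S _ x y F G; exact fP_map (aeval ![x, y] : _ →ₐ[ℤ] S).toRingHom _ _ _ _
  have mQ : ∀ {S : Type} [CommRing S] (x y : S) (F G : MvPolynomial (Fin 2) ℤ),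
    aeval (![x, y]) (fQ l s F G) = fQ l s (aeval (![x, y]) F) (aeval (![x, y]) G) := by
    intro S _ x y F G; exact fQ_map (aeval ![x, y] : _ →ₐ[ℤ] S).toRingHom _ _ _ _
  rcases lt_trichotomy (k + r) (l + s) with h | h | h
  · rw [hc_mul_not_le (fQ_hom hX0 hX1 l s) (by omega), add_zero] at hP1
    refine case1 (c := coeff 0 A) (d := coeff 0 B') hk hr hkr3 hkr hls hdet ?_ ?_
    · intro x y
      have := ev x y hP1
      simp only [map_add, map_mul, mP, mQ] at this
      simpa using this
    · intro x y
      rw [hc_mul_le (fP_hom hX0 hX1 k r) h.le] at hQ1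
      have := ev x y hQ1
      simp only [map_add, map_mul, mP, mQ] at this
      exact ⟨_, by simpa using this⟩
  · rw [hc_mul_le (fQ_hom hX0 hX1 l s) h.ge, Nat.sub_eq_zero_of_le h.le, homogeneousComponent_zero] at hP1
    rw [hc_mul_le (fP_hom hX0 hX1 k r) h.le, Nat.sub_eq_zero_of_le h.ge, homogeneousComponent_zero] at hQ1
    have gP : ∀ {S : Type} [CommRing S] (x y : S), fP k r (p * x + q * y) (w * x + v * y)
      = (coeff 0 A : ℤ) * fP k r x y + (coeff 0 B : ℤ) * fQ l s x y := by
      intro S _ x y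
      have := ev x y hP1
      simpa [mP, mQ] using this
    have gQ : ∀ {S : Type} [CommRing S] (x y : S), fQ l s (p * x + q * y) (w * x + v * y)
      = (coeff 0 A' : ℤ) * fP k r x y + (coeff 0 B' : ℤ) * fQ l s x y := by
      intro S _ x y
      have := ev x y hQ1
      simpa [mP, mQ] using this
    by_cases h5 : 5 ≤ k + r
    · rcases abc_excl h5 hdet (fun x y => gP x y) with h0 | h0
      · exfalso
        refine case3a (k := k) (r := r) (c := coeff 0 B) hl hs hdet ?_
        intro x y
        simpa [h0] using gP x y
      · refine case1 (c := coeff 0 A) (d := coeff 0 B') hk hr hkr3 hkr hls hdet ?_ ?_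
        · intro x y
          simpa [h0] using gP x y
        · intro x y
          exact ⟨_, gQ x y⟩
    · obtain ⟨k, rfl⟩ := Nat.exists_eq_add_of_le' hk
      obtain ⟨r, rfl⟩ := Nat.exists_eq_add_of_le' hr
      obtain ⟨l, rfl⟩ := Nat.exists_eq_add_of_le' hl
      obtain ⟨s, rfl⟩ := Nat.exists_eq_add_of_le' hs
      refine small (k := k) (r := r) (l := l) (s := s) (α := coeff 0 A) (β := coeff 0 B)
        (γ := coeff 0 A') (δ := coeff 0 B') (by omega) (by omega) (by omega) (by omega) hdet ?_ ?_ ?_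
      · intro x y; simpa using gP x y
      · intro x y; exact gP x y
      · intro x y; exact gQ x y
  · rw [hc_mul_not_le (fP_hom hX0 hX1 k r) (by omega), zero_add] at hQ1
    refine case2 (c := coeff 0 B') (d := coeff 0 A) hl hs hls3 hkr hls hdet ?_ ?_
    · intro x y
      have := ev x y hQ1
      simp only [map_add, map_mul, mP, mQ] at this
      simpa using this
    · intro x y
      rw [hc_mul_le (fQ_hom hX0 hX1 l s) h.le] at hP1
      have := ev x y hP1
      simp only [map_add, map_mul, mP, mQ] at this
      exact ⟨_, by simpa using this⟩

lemma prod_ite_fin {S : Type} [CommRing S] (n r : ℕ) (h : r ≤ n) (u t : S) :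
    ∏ i : Fin n, (if (i : ℕ) < r then u else t) = u ^ r * t ^ (n - r) := by
  obtain ⟨d, rfl⟩ := Nat.exists_eq_add_of_le h
  rw [Fin.prod_univ_eq_prod_range (fun i => if i < r then u else t), Finset.prod_range_add]
  rw [Finset.prod_congr rfl (g := fun _ => u) (by intro x hx; simp at hx; simp [hx])]
  simp

lemma relP {n r : ℕ} (hrn : r ≤ n) {b : Fin n → ℤ}
    (hb : ∀ i : Fin n, b i = if (i : ℕ) < r then 1 else 0) :
    (X 0 * ∏ i : Fin n, (X 0 + C (b i) * X 1) : MvPolynomial (Fin 2) ℤ)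
      = fP (n - r + 1) r (X 0) (X 1) := by
  have : ∀ i : Fin n, (X 0 + C (b i) * X 1 : MvPolynomial (Fin 2) ℤ) =
      if (i : ℕ) < r then X 0 + X 1 else X 0 := by
    intro i; rw [hb]; split_ifs <;> simp
  rw [Finset.prod_congr rfl (fun i _ => this i), prod_ite_fin n r hrn, fP]
  ring

lemma relQ {m s : ℕ} (hsm : s ≤ m) {a : Fin m → ℤ}
    (ha : ∀ j : Fin m, a j = if (j : ℕ) < s then 2 else 0) :
    (X 1 * ∏ j : Fin m, (C (a j) * X 0 + X 1) : MvPolynomial (Fin 2) ℤ)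
      = fQ (m - s + 1) s (X 0) (X 1) := by
  have : ∀ i : Fin m, (C (a i) * X 0 + X 1 : MvPolynomial (Fin 2) ℤ) =
      if (i : ℕ) < s then 2 * X 0 + X 1 else X 1 := by
    intro i; rw [ha]; split_ifs <;> simp
  rw [Finset.prod_congr rfl (fun i _ => this i), prod_ite_fin m s hsm, fQ]
  ring

/-- evaluation of the quotient ring at a point killing both relations -/
noncomputable def evR (n m : ℕ) (a : Fin m → ℤ) (b : Fin n → ℤ) {S : Type} [CommRing S] (x y : S)
    (h1 : aeval ![x, y] (X 0 * ∏ i : Fin n, (X 0 + C (b i) * X 1) : MvPolynomial (Fin 2) ℤ) = 0)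
    (h2 : aeval ![x, y] (X 1 * ∏ j : Fin m, (C (a j) * X 0 + X 1) : MvPolynomial (Fin 2) ℤ) = 0) :
    RM n m a b →+* S :=
  Ideal.Quotient.lift _ (aeval ![x, y] : MvPolynomial (Fin 2) ℤ →ₐ[ℤ] S).toRingHom (by
    intro f hf
    have : Ideal.span ({X 0 * ∏ i : Fin n, (X 0 + C (b i) * X 1),
      X 1 * ∏ j : Fin m, (C (a j) * X 0 + X 1)} : Set (MvPolynomial (Fin 2) ℤ)) ≤
      RingHom.ker (aeval ![x, y] : MvPolynomial (Fin 2) ℤ →ₐ[ℤ] S).toRingHom := by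
      rw [Ideal.span_le]
      rintro g (rfl | rfl)
      · exact h1
      · exact h2
    exact this hf)

lemma evR_mk {n m : ℕ} {a : Fin m → ℤ} {b : Fin n → ℤ} {S : Type} [CommRing S] {x y : S}
    (h1) (h2) (f : MvPolynomial (Fin 2) ℤ) :
    evR n m a b x y h1 h2 (Ideal.Quotient.mk _ f) = aeval ![x, y] f := rfl

lemma mk_eq_aeval {n m : ℕ} {a : Fin m → ℤ} {b : Fin n → ℤ} {S : Type} [CommRing S]
    (φ : RM n m a b →+* S) (f : MvPolynomial (Fin 2) ℤ) :
    φ (Ideal.Quotient.mk _ f) = aeval ![φ (z₁ n m a b), φ (z₂ n m a b)] f := by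
  have : φ.comp (Ideal.Quotient.mk _) =
      (aeval ![φ (z₁ n m a b), φ (z₂ n m a b)] : MvPolynomial (Fin 2) ℤ →ₐ[ℤ] S).toRingHom := by
    apply MvPolynomial.ringHom_ext
    · intro r; simp
    · intro i
      fin_cases i <;> simp [z₁, z₂]
  exact congrArg (fun g : MvPolynomial (Fin 2) ℤ →+* S => g f) this

lemma hom_ext_RM {n m : ℕ} {a : Fin m → ℤ} {b : Fin n → ℤ} {S : Type} [CommRing S]
    {φ ψ : RM n m a b →+* S} (h1 : φ (z₁ n m a b) = ψ (z₁ n m a b))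
    (h2 : φ (z₂ n m a b) = ψ (z₂ n m a b)) : φ = ψ := by
  refine RingHom.ext fun x => ?_
  obtain ⟨f, rfl⟩ := Ideal.Quotient.mk_surjective x
  rw [mk_eq_aeval, mk_eq_aeval, h1, h2]

lemma lin_part (f : MvPolynomial (Fin 2) ℤ) : ∃ c f1 f2 : ℤ, ∀ {S : Type} [CommRing S] (e : S), e * e = 0 → ∀ s t : ℤ,
    aeval ![(s : S) * e, (t : S) * e] f
      = (c : S) + ((f1 * s + f2 * t : ℤ) : S) * e := by
  induction f using MvPolynomial.induction_on with
  | C c => exact ⟨c, 0, 0, by intros; simp⟩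
  | add f g hf hg =>
    obtain ⟨c, f1, f2, h⟩ := hf
    obtain ⟨d, g1, g2, h'⟩ := hg
    refine ⟨c + d, f1 + g1, f2 + g2, fun {S} _ e he s t => ?_⟩
    rw [map_add, h e he, h' e he]; push_cast; ring
  | mul_X f i hf =>
    obtain ⟨c, f1, f2, h⟩ := hf
    fin_cases i
    · refine ⟨0, c, 0, fun {S} _ e he s t => ?_⟩
      rw [map_mul, h e he]
      simp
      linear_combination ((f1 * s + f2 * t) * s : S) * he
    · refine ⟨0, 0, c, fun {S} _ e he s t => ?_⟩
      rw [map_mul, h e he]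
      simp
      linear_combination ((f1 * s + f2 * t) * t : S) * he

lemma eps_coeff {c d e : ℤ} (h : (c : DualNumber ℤ) + (d : DualNumber ℤ) * DualNumber.eps
    = (e : DualNumber ℤ) * DualNumber.eps) : d = e := by
  have := congrArg TrivSqZeroExt.snd h
  simpa using this

lemma exists_ev {n m r s : ℕ} {a : Fin m → ℤ} {b : Fin n → ℤ} (hr1 : 1 ≤ r) (hrn : r ≤ n) (hs1 : 1 ≤ s) (hsm : s ≤ m) 
    (ha : ∀ j : Fin m, a j = if (j : ℕ) < s then 2 else 0) 
    (hb : ∀ i : Fin n, b i = if (i : ℕ) < r then 1 else 0) (u t : ℤ) : ∃ ψ : RM n m a b →+* DualNumber ℤ,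
    ψ (z₁ n m a b) = (u : DualNumber ℤ) * DualNumber.eps ∧
    ψ (z₂ n m a b) = (t : DualNumber ℤ) * DualNumber.eps := by
  have he : (DualNumber.eps : DualNumber ℤ) * DualNumber.eps = 0 := DualNumber.eps_mul_eps
  refine ⟨evR n m a b ((u : DualNumber ℤ) * DualNumber.eps) ((t : DualNumber ℤ) * DualNumber.eps) ?_ ?_, ?_, ?_⟩
  rotate_left 2
  · rw [z₁, evR_mk]; simp
  · rw [z₂, evR_mk]; simp
  · rw [relP hrn hb]
    obtain ⟨r, rfl⟩ := Nat.exists_eq_add_of_le' hr1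
    simp [fP, pow_succ]
    generalize (DualNumber.eps : DualNumber ℤ) = ε at *
    linear_combination ((u * ε) ^ (n - (r + 1)) * u * (u + t) * (u * ε + t * ε) ^ r) * he
  · rw [relQ hsm ha]
    obtain ⟨s, rfl⟩ := Nat.exists_eq_add_of_le' hs1
    simp [fQ, pow_succ]
    generalize (DualNumber.eps : DualNumber ℤ) = ε at *
    linear_combination ((t * ε) ^ (m - (s + 1)) * t * (2 * u + t) * (2 * (u * ε) + t * ε) ^ s) * he

lemma det_unit_s6 {n m r s : ℕ} {a : Fin m → ℤ} {b : Fin n → ℤ} (hr1 : 1 ≤ r) (hrn : r ≤ n) (hs1 : 1 ≤ s) (hsm : s ≤ m) 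
    (ha : ∀ j : Fin m, a j = if (j : ℕ) < s then 2 else 0) 
    (hb : ∀ i : Fin n, b i = if (i : ℕ) < r then 1 else 0) (φ : RingAut (RM n m a b)) {p q w v : ℤ}
    (h1 : φ (z₁ n m a b) = p • z₁ n m a b + q • z₂ n m a b)
    (h2 : φ (z₂ n m a b) = w • z₁ n m a b + v • z₂ n m a b) :
    p * v - q * w = 1 ∨ p * v - q * w = -1 := by
  have key : ∀ z : RM n m a b, ∃ c f1 f2 : ℤ, ∀ u t : ℤ, ∀ ψ : RM n m a b →+* DualNumber ℤ,
    ψ (z₁ n m a b) = (u : DualNumber ℤ) * DualNumber.eps →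
    ψ (z₂ n m a b) = (t : DualNumber ℤ) * DualNumber.eps →
    ψ z = (c : DualNumber ℤ) + ((f1 * (p * u + q * t) + f2 * (w * u + v * t) : ℤ) : DualNumber ℤ)
      * DualNumber.eps := by
    intro z
    obtain ⟨y, rfl⟩ := φ.surjective z
    obtain ⟨f, rfl⟩ := Ideal.Quotient.mk_surjective y
    obtain ⟨c, f1, f2, h⟩ := lin_part f
    refine ⟨c, f1, f2, fun u t ψ e1 e2 => ?_⟩
    have := mk_eq_aeval (ψ.comp (φ : RM n m a b →+* RM n m a b)) f
    have k1 : (ψ.comp (φ : RM n m a b →+* RM n m a b)) (z₁ n m a b) =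
      ((p * u + q * t : ℤ) : DualNumber ℤ) * DualNumber.eps := by
      simp [h1, e1, e2]; ring
    have k2 : (ψ.comp (φ : RM n m a b →+* RM n m a b)) (z₂ n m a b) =
      ((w * u + v * t : ℤ) : DualNumber ℤ) * DualNumber.eps := by
      simp [h2, e1, e2]; ring
    rw [k1, k2] at this
    exact this.trans (h _ DualNumber.eps_mul_eps _ _)
  obtain ⟨c, f1, f2, hf⟩ := key (z₁ n m a b)
  obtain ⟨d, g1, g2, hg⟩ := key (z₂ n m a b)
  obtain ⟨ψ, e1, e2⟩ := exists_ev hr1 hrn hs1 hsm ha hb 1 0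
  obtain ⟨ψ', e1', e2'⟩ := exists_ev hr1 hrn hs1 hsm ha hb 0 1
  have i1 := eps_coeff ((hf _ _ ψ e1 e2).symm.trans e1)
  have i2 := eps_coeff ((hg _ _ ψ e1 e2).symm.trans e2)
  have i3 := eps_coeff ((hf _ _ ψ' e1' e2').symm.trans e1')
  have i4 := eps_coeff ((hg _ _ ψ' e1' e2').symm.trans e2')
  have : (p * v - q * w) * (f1 * g2 - f2 * g1) = 1 := by
    simp at i1 i2 i3 i4
    linear_combination (g1 * q + g2 * v) * i1 + i4 - (g1 * p + g2 * w) * i3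
  exact (unit_mul_cases (Or.inl this)).1

lemma part1 {n m r s : ℕ} {a : Fin m → ℤ} {b : Fin n → ℤ} (hn : 2 ≤ n) (hm : 2 ≤ m) (hr1 : 1 ≤ r) (hrn : r ≤ n) (hs1 : 1 ≤ s) (hsm : s ≤ m) 
    (ha : ∀ j : Fin m, a j = if (j : ℕ) < s then 2 else 0) 
    (hb : ∀ i : Fin n, b i = if (i : ℕ) < r then 1 else 0) (hs : 2 * s ≠ m + 1) (hr : 2 * r ≠ n + 1) (φ : RingAut (RM n m a b)) {p q w v : ℤ}
    (h1 : φ (z₁ n m a b) = p • z₁ n m a b + q • z₂ n m a b)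
    (h2 : φ (z₂ n m a b) = w • z₁ n m a b + v • z₂ n m a b) : Concl p q w v := by
  have hdet := det_unit_s6 hr1 hrn hs1 hsm ha hb φ h1 h2
  have k1 : (φ : RM n m a b →+* RM n m a b) (z₁ n m a b) = Ideal.Quotient.mk _
    ((p : MvPolynomial (Fin 2) ℤ) * X 0 + (q : MvPolynomial (Fin 2) ℤ) * X 1) := by
    refine h1.trans ?_
    simp [z₁, z₂]
  have k2 : (φ : RM n m a b →+* RM n m a b) (z₂ n m a b) = Ideal.Quotient.mk _
    ((w : MvPolynomial (Fin 2) ℤ) * X 0 + (v : MvPolynomial (Fin 2) ℤ) * X 1) := by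
    refine h2.trans ?_
    simp [z₁, z₂]
  have gP : ∃ A B, A * fP (n - r + 1) r (X 0) (X 1) + B * fQ (m - s + 1) s (X 0) (X 1) =
    fP (n - r + 1) r ((p : MvPolynomial (Fin 2) ℤ) * X 0 + (q : MvPolynomial (Fin 2) ℤ) * X 1)
        ((w : MvPolynomial (Fin 2) ℤ) * X 0 + (v : MvPolynomial (Fin 2) ℤ) * X 1) := by
    rw [← Ideal.mem_span_pair, ← relP hrn hb, ← relQ hsm ha, ← Ideal.Quotient.eq_zero_iff_mem,
      fP_map, ← k1, ← k2, ← fP_map]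
    have : (fP (n - r + 1) r (z₁ n m a b) (z₂ n m a b)) = 0 := by
      rw [z₁, z₂, ← fP_map, ← relP hrn hb, Ideal.Quotient.eq_zero_iff_mem]
      exact Ideal.subset_span (by simp)
    rw [this, map_zero]
  have gQ : ∃ A B, A * fP (n - r + 1) r (X 0) (X 1) + B * fQ (m - s + 1) s (X 0) (X 1) =
    fQ (m - s + 1) s ((p : MvPolynomial (Fin 2) ℤ) * X 0 + (q : MvPolynomial (Fin 2) ℤ) * X 1)
        ((w : MvPolynomial (Fin 2) ℤ) * X 0 + (v : MvPolynomial (Fin 2) ℤ) * X 1) := by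
    rw [← Ideal.mem_span_pair, ← relP hrn hb, ← relQ hsm ha, ← Ideal.Quotient.eq_zero_iff_mem,
      fQ_map, ← k1, ← k2, ← fQ_map]
    have : (fQ (m - s + 1) s (z₁ n m a b) (z₂ n m a b)) = 0 := by
      rw [z₁, z₂, ← fQ_map, ← relQ hsm ha, Ideal.Quotient.eq_zero_iff_mem]
      exact Ideal.subset_span (by simp)
    rw [this, map_zero]
  obtain ⟨A, B, gP⟩ := gP
  obtain ⟨A', B', gQ⟩ := gQ
  exact core (by omega) hr1 (by omega) hs1 (by omega) (by omega) (by omega) (by omega) hdet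
    gP.symm gQ.symm

lemma aeval_relP {n r : ℕ} (hrn : r ≤ n) {b : Fin n → ℤ}
    (hb : ∀ i : Fin n, b i = if (i : ℕ) < r then 1 else 0) {S : Type} [CommRing S] (x y : S) :
    aeval ![x, y] (X 0 * ∏ i : Fin n, (X 0 + C (b i) * X 1) : MvPolynomial (Fin 2) ℤ)
      = fP (n - r + 1) r x y := by
  rw [relP hrn hb]
  refine (fP_map (aeval ![x, y] : MvPolynomial (Fin 2) ℤ →ₐ[ℤ] S).toRingHom _ _ _ _).trans ?_
  simp

lemma aeval_relQ {m s : ℕ} (hsm : s ≤ m) {a : Fin m → ℤ}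
    (ha : ∀ j : Fin m, a j = if (j : ℕ) < s then 2 else 0) {S : Type} [CommRing S] (x y : S) :
    aeval ![x, y] (X 1 * ∏ j : Fin m, (C (a j) * X 0 + X 1) : MvPolynomial (Fin 2) ℤ)
      = fQ (m - s + 1) s x y := by
  rw [relQ hsm ha]
  refine (fQ_map (aeval ![x, y] : MvPolynomial (Fin 2) ℤ →ₐ[ℤ] S).toRingHom _ _ _ _).trans ?_
  simp

lemma fP_neg {S : Type} [CommRing S] (k r : ℕ) (x y : S) :
    fP k r (-x) (-y) = (-1) ^ k * (-1) ^ r * fP k r x y := by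
  unfold fP
  rw [neg_pow x, ← neg_add, neg_pow (x + y)]; ring

lemma fQ_neg {S : Type} [CommRing S] (k r : ℕ) (x y : S) :
    fQ k r (-x) (-y) = (-1) ^ k * (-1) ^ r * fQ k r x y := by
  unfold fQ
  rw [neg_pow y, mul_neg, ← neg_add, neg_pow (2 * x + y)]; ring

lemma exists_neg {n m r s : ℕ} {a : Fin m → ℤ} {b : Fin n → ℤ} (hrn : r ≤ n) (hsm : s ≤ m) 
    (ha : ∀ j : Fin m, a j = if (j : ℕ) < s then 2 else 0) 
    (hb : ∀ i : Fin n, b i = if (i : ℕ) < r then 1 else 0) : ∃ σ : RingAut (RM n m a b), σ (z₁ n m a b) = - z₁ n m a b ∧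
    σ (z₂ n m a b) = - z₂ n m a b ∧ σ * σ = 1 := by
  obtain ⟨f, f1, f2⟩ : ∃ f : RM n m a b →+* RM n m a b, f (z₁ n m a b) = - z₁ n m a b ∧
      f (z₂ n m a b) = - z₂ n m a b := by
    refine ⟨evR n m a b (- z₁ n m a b) (- z₂ n m a b) ?_ ?_, ?_, ?_⟩
    rotate_left 2
    · exact aeval_X _ _
    · exact aeval_X _ _
    · refine (aeval_relP hrn hb _ _).trans ?_
      have h0 : (fP (n - r + 1) r (z₁ n m a b) (z₂ n m a b)) = 0 := by
        rw [z₁, z₂, ← fP_map, ← relP hrn hb, Ideal.Quotient.eq_zero_iff_mem]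
        exact Ideal.subset_span (by simp)
      rw [fP_neg, h0, mul_zero]
    · refine (aeval_relQ hsm ha _ _).trans ?_
      have h0 : (fQ (m - s + 1) s (z₁ n m a b) (z₂ n m a b)) = 0 := by
        rw [z₁, z₂, ← fQ_map, ← relQ hsm ha, Ideal.Quotient.eq_zero_iff_mem]
        exact Ideal.subset_span (by simp)
      rw [fQ_neg, h0, mul_zero]
  have hff : f.comp f = RingHom.id _ := hom_ext_RM (by simp [f1]) (by simp [f2])
  refine ⟨RingEquiv.ofRingHom f f hff hff, f1, f2, ?_⟩
  ext x
  exact congrArg (fun g : RM n m a b →+* RM n m a b => g x) hff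

/-- Let `n, m ≥ 2`, `a = (2,…,2,0,…,0)` with `s` twos (`1 ≤ s ≤ m`), and
`b = (1,…,1,0,…,0)` with `r` ones (`1 ≤ r ≤ n`), where `s ≠ (m+1)/2` and `r ≠ (n+1)/2`.
Then the group of graded ring automorphisms of
`R = ℤ[x₁,x₂]/⟨x₁·∏ᵢ(x₁+bᵢx₂), x₂·∏ⱼ(aⱼx₁+x₂)⟩`, identified with 2×2 integer matrices via
the action on the degree-2 part, is `{I, -I} ≅ ℤ/2`. -/
theorem stmt6 (n m r s : ℕ) (hn : 2 ≤ n) (hm : 2 ≤ m)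
    (hr1 : 1 ≤ r) (hrn : r ≤ n) (hs1 : 1 ≤ s) (hsm : s ≤ m)
    (hs : 2 * s ≠ m + 1) (hr : 2 * r ≠ n + 1)
    (a : Fin m → ℤ) (b : Fin n → ℤ)
    (ha : ∀ j : Fin m, a j = if (j : ℕ) < s then 2 else 0)
    (hb : ∀ i : Fin n, b i = if (i : ℕ) < r then 1 else 0) :
    (∀ (φ : RingAut (RM n m a b)) (g : Matrix (Fin 2) (Fin 2) ℤ),
        φ (z₁ n m a b) = g 0 0 • z₁ n m a b + g 0 1 • z₂ n m a b →
        φ (z₂ n m a b) = g 1 0 • z₁ n m a b + g 1 1 • z₂ n m a b →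
        g ∈ ({1, -1} : Set (Matrix (Fin 2) (Fin 2) ℤ))) ∧
    (∀ g ∈ ({1, -1} : Set (Matrix (Fin 2) (Fin 2) ℤ)),
        ∃ φ : RingAut (RM n m a b),
          φ (z₁ n m a b) = g 0 0 • z₁ n m a b + g 0 1 • z₂ n m a b ∧
          φ (z₂ n m a b) = g 1 0 • z₁ n m a b + g 1 1 • z₂ n m a b) ∧
    (∃ e : Multiplicative (ZMod 2) →* RingAut (RM n m a b),
        Function.Injective e ∧
        ∀ φ : RingAut (RM n m a b), φ ∈ Set.range e ↔ IsGraded n m a b φ) := by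
  obtain ⟨σ, σ1, σ2, σσ⟩ := exists_neg hrn hsm ha hb
  have P1 := fun φ p q w v => part1 (p := p) (q := q) (w := w) (v := v) hn hm hr1 hrn hs1 hsm ha hb hs hr φ
  have hne : σ ≠ 1 := by
    intro h
    obtain ⟨ψ, e1, e2⟩ := exists_ev hr1 hrn hs1 hsm ha hb 1 0
    rw [h] at σ1
    have h3 : z₁ n m a b = - z₁ n m a b := σ1
    have h4 := congrArg ψ h3
    rw [map_neg, e1] at h4
    have h5 := congrArg TrivSqZeroExt.snd h4
    simp at h5
  refine ⟨?_, ?_, ?_⟩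
  · intro φ g h1 h2
    rcases P1 φ _ _ _ _ h1 h2 with ⟨h1, h2, h3, h4⟩ | ⟨h1, h2, h3, h4⟩
    · left
      ext i j
      fin_cases i <;> fin_cases j <;> simp [h1, h2, h3, h4]
    · right
      show g = -1
      ext i j
      fin_cases i <;> fin_cases j <;> simp [h1, h2, h3, h4]
  · rintro g (rfl | rfl)
    · exact ⟨1, by simp, by simp⟩
    · exact ⟨σ, by simp [σ1], by simp [σ2]⟩
  · let f0 : {f : ℤ →+ Additive (RingAut (RM n m a b)) // f (2 : ℕ) = 0} :=
      ⟨(zmultiplesHom (Additive (RingAut (RM n m a b)))) (Additive.ofMul σ), by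
        rw [zmultiplesHom_apply]
        exact congrArg Additive.ofMul ((zpow_two σ).trans σσ)⟩
    let e0 : Multiplicative (ZMod 2) →* RingAut (RM n m a b) :=
      AddMonoidHom.toMultiplicativeLeft (ZMod.lift 2 f0)
    have h0 : e0 (Multiplicative.ofAdd 0) = 1 := map_one e0
    have h1 : e0 (Multiplicative.ofAdd 1) = σ := by
      have h2 := ZMod.lift_coe 2 f0 1
      rw [Int.cast_one] at h2
      exact congrArg Additive.toMul (h2.trans (one_zsmul _))
    have hall : ∀ x : Multiplicative (ZMod 2), x = Multiplicative.ofAdd 0 ∨ x = Multiplicative.ofAdd 1 := by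
      decide
    refine ⟨e0, ?_, ?_⟩
    · intro x y hxy
      rcases hall x with rfl | rfl <;> rcases hall y with rfl | rfl <;> simp only [h0, h1] at hxy ⊢
      · exact absurd hxy.symm hne
      · exact absurd hxy hne
    · intro φ
      constructor
      · rintro ⟨x, rfl⟩
        rcases hall x with rfl | rfl
        · rw [h0]
          exact ⟨Submodule.subset_span (by simp), Submodule.subset_span (by simp)⟩
        · rw [h1]
          constructor
          · rw [σ1]; exact Submodule.neg_mem _ (Submodule.subset_span (by simp))
          · rw [σ2]; exact Submodule.neg_mem _ (Submodule.subset_span (by simp))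
      · rintro ⟨g1, g2⟩
        obtain ⟨p, q, g1⟩ := Submodule.mem_span_pair.1 g1
        obtain ⟨w, v, g2⟩ := Submodule.mem_span_pair.1 g2
        have ext2 : ∀ τ : RingAut (RM n m a b), φ (z₁ n m a b) = τ (z₁ n m a b) →
            φ (z₂ n m a b) = τ (z₂ n m a b) → φ = τ := by
          intro τ t1 t2
          have := hom_ext_RM (φ := (φ : RM n m a b →+* RM n m a b))
            (ψ := (τ : RM n m a b →+* RM n m a b)) t1 t2
          refine RingEquiv.ext fun x => ?_
          exact congrArg (fun g : RM n m a b →+* RM n m a b => g x) this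
        rcases P1 φ _ _ _ _ g1.symm g2.symm with ⟨rfl, rfl, rfl, rfl⟩ | ⟨rfl, rfl, rfl, rfl⟩
        · refine ⟨_, h0.trans (ext2 1 ?_ ?_).symm⟩
          · rw [← g1]; simp
          · rw [← g2]; simp
        · refine ⟨_, h1.trans (ext2 σ ?_ ?_).symm⟩
          · rw [← g1, σ1]; simp
          · rw [← g2, σ2]; simp
end

section
/- Let n, m ≥ 1 and Λ be the n+m by n+m+2 characteristic matrix with Λ = (I_{n+m} | c₁ | c₂), where c₁ = (−1,…,−1, −a₁,…,−a_m)ᵀ (first n entries −1) and c₂ = (−b₁,…,−b_n, −1,…,−1)ᵀ (last m entries −1). Then Λ satisfies the non-singularity condition for the polytope Δⁿ × Δᵐ (every maximal minor corresponding to a vertex is ±1) if and only if 1 − a_j·b_i = ±1 for all i = 1,…,n and j = 1,…,m. -/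
lemma aux_one {N : Type*} [Fintype N] [DecidableEq N] (p : N) (u : N → ℤ) (M : Matrix N N ℤ)
    (hM : ∀ i j, M i j = if j = p then u i else if i = j then 1 else 0) : M.det = u p := by
  have : M = (1 : Matrix N N ℤ).updateCol p u := by
    ext i j
    rw [hM, Matrix.updateCol_apply, Matrix.one_apply]
  rw [this, ← Matrix.cramer_apply, Matrix.cramer_one]
  rfl

lemma aux_two {N : Type*} [Fintype N] [DecidableEq N] (p q : N) (hpq : p ≠ q) (u v : N → ℤ)
    (M : Matrix N N ℤ)
    (hM : ∀ i j, M i j = if j = p then u i else if j = q then v i else if i = j then 1 else 0) :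
    M.det = u p * v q - u q * v p := by
  let U : Matrix N (Fin 2) ℤ := Matrix.of fun i k =>
    if k = 0 then u i - (if i = p then 1 else 0) else v i - (if i = q then 1 else 0)
  let V : Matrix (Fin 2) N ℤ := Matrix.of fun k j =>
    if k = 0 then (if j = p then 1 else 0) else (if j = q then 1 else 0)
  have h : M = 1 + U * V := by
    ext i j
    rw [hM, Matrix.add_apply, Matrix.mul_apply, Fin.sum_univ_two, Matrix.one_apply]
    simp only [U, V, Matrix.of_apply]
    by_cases h1 : j = p
    · subst h1; simp [hpq]
    · by_cases h2 : j = q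
      · subst h2; simp [h1]
      · simp [h1, h2]
  rw [h, Matrix.det_one_add_mul_comm, Matrix.det_fin_two]
  simp [Matrix.mul_apply, U, V, hpq, hpq.symm]
  ring

def auxG (K p q : ℕ) (k : Fin K) : Fin (K + 2) :=
  if (k : ℕ) = p then ⟨K, by omega⟩ else if (k : ℕ) = q then ⟨K + 1, by omega⟩
  else ⟨k, by omega⟩

lemma auxG_val (K p q : ℕ) (k : Fin K) :
    (auxG K p q k : ℕ) = if (k : ℕ) = p then K else if (k : ℕ) = q then K + 1 else k := by
  unfold auxG; split_ifs <;> rfl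

lemma aux_perm (K : ℕ) (p q : Fin (K + 2)) (hp : (p : ℕ) ≤ K) (hq : (q : ℕ) < K ∨ (q : ℕ) = K + 1)
    (hpq : p ≠ q) (Λ : Matrix (Fin K) (Fin (K + 2)) ℤ) (f : Fin K → Fin (K + 2))
    (hf : Function.Injective f) (hfa : ∀ i, f i ≠ p ∧ f i ≠ q)
    (h : (Λ.submatrix id (auxG K p q)).det = 1 ∨ (Λ.submatrix id (auxG K p q)).det = -1) :
    (Λ.submatrix id f).det = 1 ∨ (Λ.submatrix id f).det = -1 := by
  have hpq' : (p : ℕ) ≠ q := fun h => hpq (Fin.ext h)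
  have hs : ∀ k, ∃ l, auxG K p q l = f k := by
    intro k
    have h1 : (f k : ℕ) ≠ p := fun h => (hfa k).1 (Fin.ext h)
    have h2 : (f k : ℕ) ≠ q := fun h => (hfa k).2 (Fin.ext h)
    have h3 := (f k).isLt
    by_cases h4 : (f k : ℕ) < K
    · refine ⟨⟨f k, h4⟩, Fin.ext ?_⟩
      rw [auxG_val]; simp [h1, h2]
    · by_cases h5 : (f k : ℕ) = K
      · refine ⟨⟨p, by omega⟩, Fin.ext ?_⟩
        rw [auxG_val]; simp [h5]
      · refine ⟨⟨q, by omega⟩, Fin.ext ?_⟩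
        rw [auxG_val]; simp [hpq'.symm]; omega
  choose s hs using hs
  have hsi : Function.Injective s := fun x y hxy => hf (by rw [← hs, ← hs, hxy])
  let e : Equiv.Perm (Fin K) := Equiv.ofBijective s (Finite.injective_iff_bijective.mp hsi)
  have he : Λ.submatrix id f = (Λ.submatrix id (auxG K p q)).submatrix id e := by
    ext i j
    simp [e, hs]
  rw [he, Matrix.det_permute']
  rcases Int.units_eq_one_or (Equiv.Perm.sign e) with h' | h' <;> rw [h'] <;>
    rcases h with h | h <;> rw [h] <;> simp


/-- Let `Λ = (I_{n+m} | c₁ | c₂)` be the `(n+m) × (n+m+2)` characteristic matrix on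
`Δⁿ × Δᵐ`, where `c₁ = (-1,…,-1,-a₁,…,-a_m)ᵀ` (first `n` entries `-1`) and
`c₂ = (-b₁,…,-b_n,-1,…,-1)ᵀ` (last `m` entries `-1`).  The columns with indices in
`{0,…,n-1} ∪ {n+m}` correspond to the facets of `Δⁿ`, and those in
`{n,…,n+m-1} ∪ {n+m+1}` to the facets of `Δᵐ`; vertices of `Δⁿ × Δᵐ` correspond to
deleting one column of each kind.  Then `Λ` is non-singular (every maximal minor
corresponding to a vertex has determinant `±1`) if and only if `1 - aⱼ·bᵢ = ±1` for all
`i = 1,…,n` and `j = 1,…,m`. -/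
theorem stmt15 (n m : ℕ) (hn : 1 ≤ n) (hm : 1 ≤ m)
    (a : Fin m → ℤ) (b : Fin n → ℤ)
    (Λ : Matrix (Fin (n + m)) (Fin (n + m + 2)) ℤ)
    (hid : ∀ (i : Fin (n + m)) (j : Fin (n + m + 2)), (j : ℕ) < n + m →
      Λ i j = if (i : ℕ) = (j : ℕ) then 1 else 0)
    (hc1a : ∀ i : Fin (n + m), (i : ℕ) < n → Λ i ⟨n + m, by omega⟩ = -1)
    (hc1b : ∀ j : Fin m, Λ ⟨n + (j : ℕ), by have := j.isLt; omega⟩ ⟨n + m, by omega⟩ = -(a j))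
    (hc2a : ∀ i : Fin n, Λ ⟨(i : ℕ), by have := i.isLt; omega⟩ ⟨n + m + 1, by omega⟩ = -(b i))
    (hc2b : ∀ i : Fin (n + m), n ≤ (i : ℕ) → Λ i ⟨n + m + 1, by omega⟩ = -1) :
    ((∀ p q : Fin (n + m + 2),
        ((p : ℕ) < n ∨ (p : ℕ) = n + m) →
        ((n ≤ (q : ℕ) ∧ (q : ℕ) < n + m) ∨ (q : ℕ) = n + m + 1) →
        ∀ f : Fin (n + m) → Fin (n + m + 2), Function.Injective f →
          (∀ i, f i ≠ p ∧ f i ≠ q) →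
          (Λ.submatrix id f).det = 1 ∨ (Λ.submatrix id f).det = -1)
      ↔ ∀ (i : Fin n) (j : Fin m), 1 - a j * b i = 1 ∨ 1 - a j * b i = -1) := by
  have key : ∀ (i : Fin n) (j : Fin m),
      (Λ.submatrix id (auxG (n + m) i (n + j))).det = 1 - a j * b i := by
    intro i j
    have hi := i.isLt
    have hj := j.isLt
    rw [aux_two (⟨i, by omega⟩ : Fin (n + m)) ⟨n + j, by omega⟩ (by simp [Fin.ext_iff]; omega)
      (fun k => Λ k ⟨n + m, by omega⟩) (fun k => Λ k ⟨n + m + 1, by omega⟩)]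
    · beta_reduce
      rw [hc1a _ hi, hc1b, hc2a, hc2b _ (by simp)]
      ring
    · intro k l
      simp only [Matrix.submatrix_apply, id, auxG, Fin.ext_iff]
      split_ifs with h1 h2 h3
      · rfl
      · rfl
      · rw [hid _ _ (by simp)]; simp [h3]
      · rw [hid _ _ (by simp)]; simp [h3]
  constructor
  · intro H i j
    have hi := i.isLt
    have hj := j.isLt
    rw [← key]
    refine H ⟨i, by omega⟩ ⟨n + j, by omega⟩ (Or.inl hi) (Or.inl ⟨by simp, by simp⟩) _ ?_ ?_
    · intro x y hxy
      have := congrArg Fin.val hxy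
      rw [auxG_val, auxG_val] at this
      apply Fin.ext
      have := x.isLt
      have := y.isLt
      split_ifs at * <;> omega
    · intro x
      have := x.isLt
      simp only [ne_eq, Fin.ext_iff, auxG_val]
      constructor <;> split_ifs <;> omega
  · intro H p q hp hq f hf hfa
    refine aux_perm (n + m) p q (by omega) (by omega) (fun h => by subst h; omega) Λ f hf hfa ?_
    rcases hp with hp | hp
    · rcases hq with hq | hq
      · have := key ⟨p, hp⟩ ⟨q - n, by omega⟩
        simp only [show n + ((q : ℕ) - n) = q by omega] at this
        rw [this]
        exact H _ _
      · right
        rw [aux_one (⟨p, by omega⟩ : Fin (n + m)) (fun k => Λ k ⟨n + m, by omega⟩)]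
        · exact hc1a _ hp
        · intro k l
          have hl := l.isLt
          simp only [Matrix.submatrix_apply, id, auxG, Fin.ext_iff]
          split_ifs with h1 h2 h3 h3
          · rfl
          · omega
          · omega
          · rw [hid _ _ (by simp)]; simp [h3]
          · rw [hid _ _ (by simp)]; simp [h3]
    · rcases hq with hq | hq
      · right
        rw [aux_one (⟨q, by omega⟩ : Fin (n + m)) (fun k => Λ k ⟨n + m + 1, by omega⟩)]
        · exact hc2b _ hq.1
        · intro k l
          have hl := l.isLt
          simp only [Matrix.submatrix_apply, id, auxG, Fin.ext_iff]
          rw [if_neg (by omega)]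
          split_ifs with h1 h2
          · rfl
          · rw [hid _ _ (by simp)]; simp [h2]
          · rw [hid _ _ (by simp)]; simp [h2]
      · left
        have : Λ.submatrix id (auxG (n + m) p q) = 1 := by
          ext k l
          have hl := l.isLt
          simp only [Matrix.submatrix_apply, id, auxG, Matrix.one_apply, Fin.ext_iff]
          rw [if_neg (by omega), if_neg (by omega), hid _ _ (by simp)]
        rw [this, Matrix.det_one]
end
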